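/- arXiv:2112.08188 — 8 statements merged into one kernel-verified Lean document; each statement's English description precedes it below -/
import Mathlib

section
/- Let G be a finite cut group. If G contains an element of order 14, or an element of order 15, or an element of order 21, or an element of order 35, then G contains an element of order 6. -/
/-- An element `g` of a group is *rational* if `g ^ k` is conjugate to `g`
for every integer `k` coprime to the order of `g`. -/
def IsRationalElement {G : Type*} [Group G] (g : G) : Prop :=
  ∀ k : ℤ, Int.gcd k (orderOf g) = 1 → IsConj (g ^ k) g

/-- An element `g` of a group is *inverse semi-rational* if `g ^ k` is conjugate
to `g` or to `g⁻¹` for every integer `k` coprime to the order of `g`. -/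
def IsInverseSemiRationalElement {G : Type*} [Group G] (g : G) : Prop :=
  ∀ k : ℤ, Int.gcd k (orderOf g) = 1 → IsConj (g ^ k) g ∨ IsConj (g ^ k) g⁻¹

/-- A group is a *cut group* if every element is inverse semi-rational. -/
def IsCutGroup (G : Type*) [Group G] : Prop :=
  ∀ g : G, IsInverseSemiRationalElement g

/-- A group is *rational* if every element is rational. -/
def IsRationalGroup (G : Type*) [Group G] : Prop :=
  ∀ g : G, IsRationalElement g

/-- Powers of conjugate elements are conjugate. -/
theorem IsConj.zpow_zpow {G : Type*} [Group G] {a b : G} (h : IsConj a b) (k : ℤ) :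
    IsConj (a ^ k) (b ^ k) := by
  obtain ⟨c, rfl⟩ := isConj_iff.1 h
  exact isConj_iff.2 ⟨c, conj_zpow.symm⟩

/-- An inverse semi-rational element is conjugate to its powers with exponent the square of an
integer coprime to its order. -/
theorem IsInverseSemiRationalElement.isConj_zpow_sq {G : Type*} [Group G] {g : G}
    (hg : IsInverseSemiRationalElement g) {k : ℤ} (hk : Int.gcd k (orderOf g) = 1) :
    IsConj g (g ^ (k * k)) := by
  rw [zpow_mul]
  rcases hg k hk with h | h
  · exact ((h.zpow_zpow k).trans h).symm
  · have h1 : IsConj (g ^ k)⁻¹ g := by simpa using h.zpow_zpow (-1)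
    have h2 := h.zpow_zpow k
    rw [inv_zpow] at h2
    exact (h2.trans h1).symm

/-- If conjugation by `x` raises `g` to a power and induces an automorphism of prime order `p`
on the subgroup generated by `g`, then `p` divides the order of `x`. -/
theorem dvd_orderOf_of_conj_eq_zpow {G : Type*} [Group G] [Finite G] {g x : G} {m : ℤ} {p : ℕ}
    (hp : p.Prime) (hx : SemiconjBy x g (g ^ m)) (hm : ¬ (orderOf g : ℤ) ∣ m - 1)
    (hmp : (orderOf g : ℤ) ∣ m ^ p - 1) : p ∣ orderOf x := by
  by_contra hd
  have hpow : ∀ n : ℕ, SemiconjBy (x ^ n) g (g ^ (m ^ n)) := by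
    intro n
    induction n with
    | zero => simp
    | succ n ih =>
      rw [pow_succ x, pow_succ m, zpow_mul]
      exact (ih.zpow_right m).mul_left hx
  have hcomm : Commute (x ^ p) g := by
    have h : g ^ (m ^ p) = g := by
      rw [← zpow_one g, ← zpow_mul, one_mul]
      exact (orderOf_dvd_sub_iff_zpow_eq_zpow).1 hmp
    have h' := hpow p
    rwa [h] at h'
  obtain ⟨n, hn⟩ := exists_pow_eq_self_of_coprime ((Nat.Prime.coprime_iff_not_dvd hp).2 hd)
  have hxg : Commute x g := hn ▸ hcomm.pow_left n
  apply hm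
  rw [orderOf_dvd_sub_iff_zpow_eq_zpow, zpow_one]
  exact mul_right_cancel (hx.eq.symm.trans hxg.eq)

/-- If `g` is conjugate to `g ^ m` by an element inducing an automorphism of prime order `p` on the
subgroup generated by `g` and fixing `g ^ d`, an element of order `q` coprime to `p`,
then the group has an element of order `p * q`. -/
theorem exists_orderOf_eq_mul_of_isConj_zpow {G : Type*} [Group G] [Finite G] {g : G} {m : ℤ}
    {p q d : ℕ} (hp : p.Prime) (hpq : p.Coprime q) (hd : d ≠ 0) (hg : orderOf g = d * q)
    (hconj : IsConj g (g ^ m)) (hm : ¬ (orderOf g : ℤ) ∣ m - 1)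
    (hmp : (orderOf g : ℤ) ∣ m ^ p - 1) (hmd : (orderOf g : ℤ) ∣ m * d - d) :
    ∃ y : G, orderOf y = p * q := by
  obtain ⟨x, hx⟩ := isConj_iff.1 hconj
  have hx' : SemiconjBy x g (g ^ m) := by rw [← hx]; exact SemiconjBy.conj_mk x g
  obtain ⟨e, he⟩ := dvd_orderOf_of_conj_eq_zpow hp hx' hm hmp
  have he0 : e ≠ 0 := by
    rintro rfl
    exact (orderOf_pos x).ne' (by simpa using he)
  have hcomm : Commute x (g ^ d) := by
    have h := hx'.pow_right d
    rwa [← zpow_natCast (g ^ m) d, ← zpow_mul, (orderOf_dvd_sub_iff_zpow_eq_zpow).1 hmd,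
      zpow_natCast] at h
  have h1 : orderOf (x ^ e) = p := by
    rw [orderOf_pow_of_dvd he0 (he ▸ dvd_mul_left e p), he,
      Nat.mul_div_cancel _ (Nat.pos_of_ne_zero he0)]
  have h2 : orderOf (g ^ d) = q := by
    rw [orderOf_pow_of_dvd hd (hg ▸ dvd_mul_right d q), hg,
      Nat.mul_div_cancel_left _ (Nat.pos_of_ne_zero hd)]
  refine ⟨x ^ e * g ^ d, ?_⟩
  rw [(hcomm.pow_left e).orderOf_mul_eq_mul_orderOf_of_coprime (by rwa [h1, h2]), h1, h2]

/-- A finite cut group with an element of order 14 has an element of order 6. -/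
theorem IsCutGroup.exists_orderOf_eq_six_of_fourteen {G : Type*} [Group G] [Finite G]
    (hcut : IsCutGroup G) (h : ∃ g : G, orderOf g = 14) : ∃ g : G, orderOf g = 6 := by
  obtain ⟨g, hg⟩ := h
  have hc := (hcut g).isConj_zpow_sq (k := 3) (by rw [hg]; decide)
  exact exists_orderOf_eq_mul_of_isConj_zpow (p := 3) (q := 2) (d := 7) (by norm_num)
    (by norm_num) (by norm_num) hg hc (by rw [hg]; norm_num) (by rw [hg]; norm_num)
    (by rw [hg]; norm_num)

theorem stmt_2 (G : Type*) [Group G] [Finite G] (hcut : IsCutGroup G)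
    (h : (∃ g : G, orderOf g = 14) ∨ (∃ g : G, orderOf g = 15) ∨
      (∃ g : G, orderOf g = 21) ∨ (∃ g : G, orderOf g = 35)) :
    ∃ g : G, orderOf g = 6 := by
  rcases h with h | ⟨g, hg⟩ | ⟨g, hg⟩ | ⟨g, hg⟩
  · exact hcut.exists_orderOf_eq_six_of_fourteen h
  · have hc := (hcut g).isConj_zpow_sq (k := 2) (by rw [hg]; decide)
    exact exists_orderOf_eq_mul_of_isConj_zpow (p := 2) (q := 3) (d := 5) (by norm_num)
      (by norm_num) (by norm_num) hg hc (by rw [hg]; norm_num) (by rw [hg]; norm_num)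
      (by rw [hg]; norm_num)
  · rcases hcut g 8 (by rw [hg]; decide) with hc | hc
    · exact hcut.exists_orderOf_eq_six_of_fourteen <|
        exists_orderOf_eq_mul_of_isConj_zpow (p := 2) (q := 7) (d := 3) (by norm_num)
          (by norm_num) (by norm_num) hg hc.symm (by rw [hg]; norm_num) (by rw [hg]; norm_num)
          (by rw [hg]; norm_num)
    · have hc' : IsConj g (g ^ (-8 : ℤ)) := by
        have h := (hc.zpow_zpow (-1)).symm
        rwa [← zpow_mul, zpow_neg_one, inv_inv] at h
      exact exists_orderOf_eq_mul_of_isConj_zpow (p := 2) (q := 3) (d := 7) (by norm_num)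
        (by norm_num) (by norm_num) hg hc' (by rw [hg]; norm_num) (by rw [hg]; norm_num)
        (by rw [hg]; norm_num)
  · have hc := (hcut g).isConj_zpow_sq (k := 22) (by rw [hg]; decide)
    exact hcut.exists_orderOf_eq_six_of_fourteen <|
      exists_orderOf_eq_mul_of_isConj_zpow (p := 2) (q := 7) (d := 5) (by norm_num)
        (by norm_num) (by norm_num) hg hc (by rw [hg]; norm_num) (by rw [hg]; norm_num)
        (by rw [hg]; norm_num)
end

section
/- Let G be a finite cut group. If G contains an element of order 35, then G contains an element of order 14 and an element of order 15. -/
theorem SemiconjBy.pow_left_of_zpow {G : Type*} [Group G] {x g : G} {a : ℤ}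
    (h : SemiconjBy x g (g ^ a)) (n : ℕ) : SemiconjBy (x ^ n) g (g ^ (a ^ n)) := by
  induction n with
  | zero => simp
  | succ n ih =>
    rw [pow_succ, pow_succ, zpow_mul]
    exact (ih.zpow_right a).mul_left h

/-- The square of an exponent coprime to the order of an inverse semi-rational element is
realized by conjugation. -/
theorem IsInverseSemiRationalElement.exists_semiconjBy_sq {G : Type*} [Group G] {g : G}
    (hg : IsInverseSemiRationalElement g) {k : ℤ} (hk : Int.gcd k (orderOf g) = 1) :
    ∃ x : G, SemiconjBy x g (g ^ (k ^ 2)) := by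
  rcases hg k hk with h | h
  · obtain ⟨x, hx⟩ := isConj_iff.1 h.symm
    have hx' : SemiconjBy x g (g ^ k) := by rw [← hx]; simp [SemiconjBy]
    exact ⟨x ^ 2, hx'.pow_left_of_zpow 2⟩
  · obtain ⟨x, hx⟩ := isConj_iff.1 h.symm
    have hx' : SemiconjBy x g (g ^ (-k)) := by
      rw [zpow_neg, ← hx]; simp [SemiconjBy, mul_assoc]
    exact ⟨x ^ 2, by simpa using hx'.pow_left_of_zpow 2⟩

/-- If `x ^ p` commutes with `g` but `x` does not, then `p` divides the order of `x`. -/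
theorem dvd_orderOf_of_commute_pow {G : Type*} [Group G] {x g : G} {p : ℕ}
    (hp : p.Prime) (hcomm : Commute (x ^ p) g) (hncomm : ¬ Commute x g) : p ∣ orderOf x := by
  by_contra hdvd
  obtain ⟨m, hm⟩ := exists_pow_eq_self_of_coprime ((hp.coprime_iff_not_dvd).2 hdvd)
  exact hncomm (hm ▸ hcomm.pow_left m)

/-- If conjugation by `x` is a nontrivial automorphism of prime exponent `p` on `⟨g⟩` that fixes
`u`, and `p` is coprime to the order of `u`, then there is an element of order `p * orderOf u`. -/
theorem exists_orderOf_eq_prime_mul {G : Type*} [Group G] [Finite G] {x g u : G} {p : ℕ}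
    (hp : p.Prime) (hcomm : Commute (x ^ p) g) (hncomm : ¬ Commute x g) (hu : Commute x u)
    (hcop : p.Coprime (orderOf u)) : ∃ z : G, orderOf z = p * orderOf u := by
  have horder : orderOf (x ^ (orderOf x / p)) = p :=
    orderOf_pow_orderOf_div (orderOf_pos x).ne' (dvd_orderOf_of_commute_pow hp hcomm hncomm)
  refine ⟨x ^ (orderOf x / p) * u, ?_⟩
  rw [(hu.pow_left _).orderOf_mul_eq_mul_orderOf_of_coprime (by rwa [horder]), horder]

/-- An inverse semi-rational element `g` and a coprime exponent `k` whose square has prime order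
`p` modulo the order of `g` and is trivial on `g ^ m` yield an element of order
`p * orderOf (g ^ m)`. -/
theorem IsInverseSemiRationalElement.exists_orderOf_eq {G : Type*} [Group G] [Finite G] {g : G}
    (hg : IsInverseSemiRationalElement g) {k : ℤ} {p m : ℕ} (hp : p.Prime)
    (hk : Int.gcd k (orderOf g) = 1) (hpow : (k ^ 2) ^ p ≡ 1 [ZMOD orderOf g])
    (hne : ¬ k ^ 2 ≡ 1 [ZMOD orderOf g]) (hm : m * k ^ 2 ≡ m [ZMOD orderOf g])
    (hcop : p.Coprime (orderOf (g ^ m))) : ∃ z : G, orderOf z = p * orderOf (g ^ m) := by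
  obtain ⟨x, hx⟩ := hg.exists_semiconjBy_sq hk
  refine exists_orderOf_eq_prime_mul (x := x) (g := g) hp ?_ ?_ ?_ hcop
  · have h := hx.pow_left_of_zpow p
    rwa [zpow_eq_zpow_iff_modEq.2 hpow, zpow_one] at h
  · intro h
    apply hne
    rw [← zpow_eq_zpow_iff_modEq, zpow_one]
    exact mul_right_cancel (hx.eq.symm.trans h.eq)
  · have h := hx.zpow_right m
    rwa [← zpow_mul, mul_comm, zpow_eq_zpow_iff_modEq.2 hm, zpow_natCast] at h

theorem stmt_3 (G : Type*) [Group G] [Finite G] (hcut : IsCutGroup G)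
    (h : ∃ g : G, orderOf g = 35) :
    (∃ g : G, orderOf g = 14) ∧ (∃ g : G, orderOf g = 15) := by
  obtain ⟨g, hg⟩ := h
  have h5 : orderOf (g ^ 5) = 7 := by rw [orderOf_pow, hg]; norm_num
  have h7 : orderOf (g ^ 7) = 5 := by rw [orderOf_pow, hg]; norm_num
  constructor
  · have h := (hcut g).exists_orderOf_eq (k := 8) (p := 2) (m := 5) Nat.prime_two
      (by rw [hg]; decide) (by rw [hg]; decide) (by rw [hg]; decide) (by rw [hg]; decide)
      (by rw [h5]; decide)
    rwa [h5] at h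
  · have h := (hcut g).exists_orderOf_eq (k := 16) (p := 3) (m := 7) Nat.prime_three
      (by rw [hg]; decide) (by rw [hg]; decide) (by rw [hg]; decide) (by rw [hg]; decide)
      (by rw [h7]; decide)
    rwa [h7] at h
end

section
/- Let G be a finite group, let p be an odd prime with p ≡ 1 (mod 4), let n be a positive integer, and let g be an element of G whose order is p^n or 2·p^n. Then g is rational in G if and only if g is inverse semi-rational in G. -/
/-- A rational element is inverse semi-rational. -/
theorem IsRationalElement.isInverseSemiRationalElement {G : Type*} [Group G] {g : G}
    (h : IsRationalElement g) : IsInverseSemiRationalElement g :=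
  fun k hk ↦ Or.inl (h k hk)

/-- If `-1` is a square modulo the order of an inverse semi-rational element `g`, then `g` is
conjugate to its inverse. -/
theorem IsInverseSemiRationalElement.isConj_inv {G : Type*} [Group G] {g : G}
    (h : IsInverseSemiRationalElement g) {s : ℤ} (hs : (orderOf g : ℤ) ∣ s ^ 2 + 1) :
    IsConj g⁻¹ g := by
  have hcop : IsCoprime s (orderOf g : ℤ) := by
    obtain ⟨c, hc⟩ := hs
    exact ⟨-s, c, by linear_combination -hc⟩
  have hsq : (g ^ s) ^ s = g⁻¹ := by
    rw [← zpow_mul, ← pow_two, eq_inv_iff_mul_eq_one, ← zpow_add_one]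
    exact orderOf_dvd_iff_zpow_eq_one.1 hs
  rcases h s (Int.isCoprime_iff_gcd_eq_one.1 hcop) with h₁ | h₁
  · have h₂ := h₁.zpow_zpow s
    rw [hsq] at h₂
    exact h₂.trans h₁
  · have h₂ := h₁.zpow_zpow s
    have h₃ := h₁.zpow_zpow (-1)
    rw [hsq, inv_zpow] at h₂
    rw [zpow_neg_one, zpow_neg_one, inv_inv] at h₃
    exact h₂.trans h₃

/-- An inverse semi-rational element `g` is rational if `-1` is a square modulo its order. -/
theorem IsInverseSemiRationalElement.isRationalElement {G : Type*} [Group G] {g : G}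
    (h : IsInverseSemiRationalElement g) {s : ℤ} (hs : (orderOf g : ℤ) ∣ s ^ 2 + 1) :
    IsRationalElement g :=
  fun k hk ↦ (h k hk).elim id fun h₁ ↦ h₁.trans (h.isConj_inv hs)

/-- For a prime `p` congruent to `1` modulo `4`, the integer `-1` is a square modulo twice any
power of `p`. -/
theorem Nat.Prime.exists_two_mul_pow_dvd_sq_add_one {p : ℕ} (hp : p.Prime) (hmod : p % 4 = 1)
    (n : ℕ) : ∃ s : ℤ, 2 * (p : ℤ) ^ n ∣ s ^ 2 + 1 := by
  have : Fact p.Prime := ⟨hp⟩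
  have hodd : Odd p := Nat.odd_iff.2 (by omega)
  obtain ⟨y, hy⟩ := ZMod.exists_sq_eq_neg_one_iff.2 (show p % 4 ≠ 3 by omega)
  obtain ⟨t, rfl⟩ := ZMod.intCast_surjective y
  obtain ⟨u, hu, hpu⟩ : ∃ u : ℤ, Odd u ∧ (p : ℤ) ∣ u ^ 2 - (-1) := by
    have ht : (p : ℤ) ∣ t ^ 2 - (-1) := by
      rw [← ZMod.intCast_zmod_eq_zero_iff_dvd _ p]
      push_cast
      rw [hy]
      ring
    rcases Int.even_or_odd t with he | ho
    · refine ⟨t + p, he.add_odd (by exact_mod_cast hodd), ?_⟩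
      have : (t + p) ^ 2 - (-1) = (t ^ 2 - (-1)) + (p : ℤ) * (2 * t + p) := by ring
      rw [this]
      exact ht.add (dvd_mul_right _ _)
    · exact ⟨t, ho, ht⟩
  refine ⟨u ^ p ^ n, IsCoprime.mul_dvd ?_ ?_ ?_⟩
  · exact_mod_cast Nat.isCoprime_iff_coprime.2 (hodd.pow (n := n)).coprime_two_left
  · exact ((hu.pow.pow).add_odd odd_one).two_dvd
  · have h := (pow_dvd_pow (p : ℤ) n.le_succ).trans (dvd_sub_pow_of_dvd_sub hpu n)
    rwa [hodd.pow.neg_one_pow, sub_neg_eq_add, pow_right_comm] at h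

theorem stmt_4 (G : Type*) [Group G] [Finite G] (p n : ℕ) (hp : p.Prime) (hodd : Odd p)
    (hmod : p % 4 = 1) (hn : 0 < n) (g : G)
    (hg : orderOf g = p ^ n ∨ orderOf g = 2 * p ^ n) :
    IsRationalElement g ↔ IsInverseSemiRationalElement g := by
  obtain ⟨s, hs⟩ := hp.exists_two_mul_pow_dvd_sq_add_one hmod n
  have hdvd : (orderOf g : ℤ) ∣ 2 * (p : ℤ) ^ n := by
    rcases hg with h | h <;> simp [h]
  exact ⟨fun h ↦ h.isInverseSemiRationalElement, fun h ↦ h.isRationalElement (hdvd.trans hs)⟩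
end

section
/- Let G be a finite cut group, let p be a prime, and let P be a Sylow p-subgroup of G. If P is abelian, then the exponent of P divides p or divides 4. -/
/-- An element normalizing an abelian Sylow `p`-subgroup `P` acts on `P` with order prime to `p`; in
particular, if it raises `x ∈ P` to the `k`-th power, then `k` has order prime to `p` modulo the
order of `x`. -/
theorem Sylow.exists_not_dvd_zpow_pow_eq_self {G : Type*} [Group G] [Finite G] {p : ℕ}
    [Fact p.Prime] (P : Sylow p G) [IsMulCommutative (P : Subgroup G)] {x y : G} {k : ℤ}
    (hx : x ∈ P) (hy : y ∈ Subgroup.normalizer (P : Set G)) (h : y * x * y⁻¹ = x ^ k) :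
    ∃ m : ℕ, ¬ p ∣ m ∧ x ^ (k ^ m) = x := by
  have hp : p.Prime := Fact.out
  obtain ⟨a, m, hm, hym⟩ :=
    Nat.exists_eq_pow_mul_and_not_dvd (orderOf_pos y).ne' p hp.ne_one
  have hz : y ^ m ∈ P := by
    have hpz : IsPGroup p (Subgroup.zpowers (y ^ m)) := by
      rintro ⟨z, hz⟩
      obtain ⟨i, rfl⟩ := Subgroup.mem_zpowers_iff.1 hz
      refine ⟨a, Subtype.ext ?_⟩
      change ((y ^ m) ^ i) ^ p ^ a = 1
      rw [← zpow_natCast, zpow_comm, zpow_natCast, ← pow_mul, mul_comm m, ← hym,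
        pow_orderOf_eq_one, one_zpow]
    have hmem : y ^ m ∈ Subgroup.zpowers (y ^ m) ⊓ Subgroup.normalizer (P : Set G) :=
      ⟨Subgroup.mem_zpowers _, pow_mem hy m⟩
    rw [hpz.inf_normalizer_sylow P] at hmem
    exact hmem.2
  have hconj : ∀ i : ℕ, y ^ i * x * (y ^ i)⁻¹ = x ^ (k ^ i) := by
    intro i
    induction i with
    | zero => simp
    | succ i ih =>
      calc y ^ (i + 1) * x * (y ^ (i + 1))⁻¹ = y * (y ^ i * x * (y ^ i)⁻¹) * y⁻¹ := by
            rw [pow_succ']; group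
        _ = x ^ (k ^ (i + 1)) := by rw [ih, ← conj_zpow, h, ← zpow_mul, pow_succ']
  refine ⟨m, hm, ?_⟩
  rw [← hconj, mul_inv_eq_iff_eq_mul]
  exact congrArg Subtype.val (mul_comm' (⟨y ^ m, hz⟩ : (P : Subgroup G)) ⟨x, hx⟩)

/-- If `x` is an inverse semi-rational element of an abelian Sylow `p`-subgroup and `k` is an
integer prime to the order of `x`, then `k` or `-k` has order prime to `p` modulo the order
of `x`. -/
theorem IsInverseSemiRationalElement.exists_dvd_pow_sub_one {G : Type*} [Group G] [Finite G]
    {p : ℕ} [Fact p.Prime] (P : Sylow p G) [IsMulCommutative (P : Subgroup G)] {x : G}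
    (h : IsInverseSemiRationalElement x) (hx : x ∈ P) {k : ℤ} (hk : Int.gcd k (orderOf x) = 1) :
    ∃ m : ℕ, ¬ p ∣ m ∧ ((orderOf x : ℤ) ∣ k ^ m - 1 ∨ (orderOf x : ℤ) ∣ (-k) ^ m - 1) := by
  have key : ∀ l : ℤ, IsConj x (x ^ l) → ∃ m : ℕ, ¬ p ∣ m ∧ (orderOf x : ℤ) ∣ l ^ m - 1 := by
    intro l hl
    obtain ⟨g, hg⟩ := isConj_iff.1 hl
    have hg' : g⁻¹⁻¹ * x * g⁻¹ = x ^ l := by simpa using hg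
    obtain ⟨y, hy, hxy⟩ := P.conj_eq_normalizer_conj_of_mem x g⁻¹ hx
      (by rw [hg']; exact zpow_mem hx l)
    obtain ⟨m, hm, hmx⟩ := P.exists_not_dvd_zpow_pow_eq_self (y := y⁻¹) hx (inv_mem hy)
      (by rw [inv_inv, ← hxy, hg'])
    refine ⟨m, hm, orderOf_dvd_iff_zpow_eq_one.2 ?_⟩
    rw [zpow_sub, hmx, zpow_one, mul_inv_cancel]
  obtain h | h := h k hk
  · obtain ⟨m, hm, hd⟩ := key k h.symm
    exact ⟨m, hm, .inl hd⟩
  · obtain ⟨m, hm, hd⟩ := key (-k) (by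
      obtain ⟨g, hg⟩ := isConj_iff.1 h.symm
      exact isConj_iff.2 ⟨g, by rw [zpow_neg, ← hg, conj_inv, inv_inv]⟩)
    exact ⟨m, hm, .inr hd⟩

theorem sq_dvd_one_add_pow_sub (p : ℤ) (n : ℕ) : p ^ 2 ∣ (1 + p) ^ n - (1 + n * p) := by
  induction n with
  | zero => simp
  | succ n ih =>
    obtain ⟨c, hc⟩ := ih
    exact ⟨c * (1 + p) + n, by push_cast; linear_combination (1 + p) * hc⟩

/-- A `p`-element whose order does not divide `p ^ n` has a power of order `p ^ (n + 1)`. -/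
theorem IsPGroup.exists_orderOf_eq_prime_pow_succ {G : Type*} [Group G] {p : ℕ} [Fact p.Prime]
    (hG : IsPGroup p G) {x : G} {n : ℕ} (hx : x ^ p ^ n ≠ 1) :
    ∃ y : G, orderOf y = p ^ (n + 1) := by
  have hp : p.Prime := Fact.out
  obtain ⟨a, ha⟩ := IsPGroup.iff_orderOf.1 hG x
  have hna : n + 1 ≤ a := by
    by_contra! hlt
    exact hx (orderOf_dvd_iff_pow_eq_one.1 (ha ▸ pow_dvd_pow p (by omega)))
  refine ⟨x ^ p ^ (a - (n + 1)), ?_⟩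
  rw [orderOf_pow_of_dvd (pow_pos hp.pos _).ne' (ha ▸ pow_dvd_pow p (by omega)), ha,
    Nat.pow_div (by omega) hp.pos]
  congr 1
  omega



theorem stmt_7 (G : Type*) [Group G] [Finite G] (hcut : IsCutGroup G)
    (p : ℕ) (hp : p.Prime) (P : Sylow p G)
    (hab : ∀ a b : ↥(P : Subgroup G), a * b = b * a) :
    Monoid.exponent ↥(P : Subgroup G) ∣ p ∨ Monoid.exponent ↥(P : Subgroup G) ∣ 4 := by
  have : Fact p.Prime := ⟨hp⟩
  have : IsMulCommutative (P : Subgroup G) := ⟨⟨hab⟩⟩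
  obtain rfl | hodd := hp.eq_two_or_odd'
  · right
    rw [Monoid.exponent_dvd_iff_forall_pow_eq_one]
    by_contra! hne
    obtain ⟨x, hx⟩ := hne
    obtain ⟨⟨y, hyP⟩, hy⟩ := P.isPGroup'.exists_orderOf_eq_prime_pow_succ (n := 2) hx
    rw [Subgroup.orderOf_mk] at hy
    obtain ⟨m, hm, hd⟩ := (hcut y).exists_dvd_pow_sub_one P hyP (k := 5) (by rw [hy]; rfl)
    obtain ⟨j, rfl⟩ : Odd m := by rwa [← Nat.not_even_iff_odd, even_iff_two_dvd]
    have h25 : (25 : ℤ) ^ j ≡ 1 [ZMOD 8] := by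
      simpa using Int.ModEq.pow j (show (25 : ℤ) ≡ 1 [ZMOD 8] from rfl)
    rw [hy] at hd
    norm_num [pow_succ, pow_mul] at hd
    have := h25.dvd
    omega
  · left
    rw [Monoid.exponent_dvd_iff_forall_pow_eq_one]
    by_contra! hne
    obtain ⟨x, hx⟩ := hne
    obtain ⟨⟨y, hyP⟩, hy⟩ := P.isPGroup'.exists_orderOf_eq_prime_pow_succ (n := 1)
      (by rwa [pow_one])
    rw [Subgroup.orderOf_mk] at hy
    obtain ⟨m, hm, hd⟩ := (hcut y).exists_dvd_pow_sub_one P hyP (k := 1 + p) (by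
      rw [hy, ← Int.isCoprime_iff_gcd_eq_one]
      push_cast
      exact IsCoprime.pow_right ⟨1, -1, by ring⟩)
    have hd2 : (p : ℤ) ^ 2 ∣ (1 + p) ^ (m * 2) - 1 := by
      rw [hy] at hd
      push_cast at hd
      obtain hd | hd := hd
      · exact hd.trans (by simpa [pow_mul] using sub_dvd_pow_sub_pow ((1 + p : ℤ) ^ m) 1 2)
      · have := hd.trans (sub_dvd_pow_sub_pow ((-(1 + p) : ℤ) ^ m) 1 2)
        rwa [one_pow, ← pow_mul, (even_two.mul_left m).neg_pow] at this
    have hdvd : (p : ℤ) * p ∣ (m * 2 : ℕ) * p := by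
      have := dvd_sub hd2 (sq_dvd_one_add_pow_sub p (m * 2))
      rwa [sub_sub_sub_cancel_left, add_sub_cancel_left, sq] at this
    have hpm : p ∣ m * 2 := by
      exact_mod_cast Int.dvd_of_mul_dvd_mul_right (by exact_mod_cast hp.ne_zero) hdvd
    obtain h | h := hp.dvd_mul.1 hpm
    · exact hm h
    · obtain rfl := (Nat.prime_dvd_prime_iff_eq hp Nat.prime_two).1 h
      exact absurd hodd (by decide)
end

section
/- Let G be a finite cut group, and let p and q be distinct primes dividing the order of G. Let P be a Sylow p-subgroup and Q a Sylow q-subgroup of G. Suppose that P is normal in G and that G contains no element of order p·q. Then Q is isomorphic to the quaternion group of order 8, or Q is cyclic with order dividing 4, or Q is cyclic of order q. -/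
/-- Commuting elements of order `q` generate the same subgroup. -/
def CommutingOrderCyclic (G : Type*) [Group G] (q : ℕ) : Prop :=
  ∀ a b : G, Commute a b → orderOf a = q → orderOf b = q → a ∈ Subgroup.zpowers b

theorem CommutingOrderCyclic.subgroup {G : Type*} [Group G] {q : ℕ}
    (h : CommutingOrderCyclic G q) (H : Subgroup G) : CommutingOrderCyclic H q := by
  intro a b hab ha hb
  obtain ⟨k, hk⟩ := h a b (by simpa using hab.map H.subtype)
    (by rwa [Subgroup.orderOf_coe]) (by rwa [Subgroup.orderOf_coe])
  exact ⟨k, Subtype.ext (by simpa using hk)⟩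

theorem prod_range_apply_pow_eq_one {G V : Type*} [Group G] [CommGroup V] (φ : G →* MulAut V)
    {q : ℕ} {t : G} (ht : orderOf t = q) (hfix : ∀ w, φ t w = w → w = 1) (v : V) :
    ∏ j ∈ Finset.range q, φ (t ^ j) v = 1 := by
  apply hfix
  have hstep : ∀ j, φ t (φ (t ^ j) v) = φ (t ^ (j + 1)) v := fun j => by
    rw [pow_succ', map_mul, MulAut.mul_apply]
  have h1 := Finset.prod_range_succ (fun j => φ (t ^ j) v) q
  have h2 := Finset.prod_range_succ' (fun j => φ (t ^ j) v) q
  rw [map_prod, Finset.prod_congr rfl (fun j _ => hstep j)]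
  have h3 : t ^ q = 1 := ht ▸ pow_orderOf_eq_one t
  rw [h1] at h2
  simpa [h3] using h2.symm

theorem commutingOrderCyclic_of_fixedPointFree {G V : Type*} [Group G] [CommGroup V]
    (φ : G →* MulAut V) {q : ℕ} (hq : q.Prime) {v : V} (hv : v ^ q ≠ 1)
    (hfix : ∀ t : G, orderOf t = q → ∀ w, φ t w = w → w = 1) : CommutingOrderCyclic G q := by
  intro a b hab ha hb
  by_contra hmem
  have haq : a ^ q = 1 := ha ▸ pow_orderOf_eq_one a
  have hbq : b ^ q = 1 := hb ▸ pow_orderOf_eq_one b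
  have := Fact.mk hq
  have hord : ∀ i : ℕ, orderOf (a * b ^ i) = q := fun i => by
    apply orderOf_eq_prime
    · rw [(hab.pow_right i).mul_pow, haq, ← pow_mul, mul_comm, pow_mul, hbq, one_pow, one_mul]
    · intro h
      exact hmem ⟨-i, by rw [eq_inv_of_mul_eq_one_left h]; simp⟩
  have hrows : ∏ i ∈ Finset.range q, ∏ j ∈ Finset.range q, φ ((a * b ^ i) ^ j) v = 1 :=
    Finset.prod_eq_one fun i _ => prod_range_apply_pow_eq_one φ (hord i) (hfix _ (hord i)) v
  rw [Finset.prod_comm, Finset.prod_eq_single_of_mem 0 (Finset.mem_range.2 hq.pos)] at hrows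
  · exact hv (by simpa using hrows)
  · intro j hj hj0
    have hbj : orderOf (b ^ j) = q := by
      apply orderOf_eq_prime
      · rw [← pow_mul, mul_comm, pow_mul, hbq, one_pow]
      · intro h
        have := orderOf_dvd_of_pow_eq_one h
        rw [hb] at this
        exact absurd (Nat.le_of_dvd (by omega) this) (by simpa using hj)
    have hterm : ∀ i, φ ((a * b ^ i) ^ j) v = φ (a ^ j) (φ ((b ^ j) ^ i) v) := fun i => by
      rw [(hab.pow_right i).mul_pow, map_mul, MulAut.mul_apply, ← pow_mul, ← pow_mul, mul_comm i]
    rw [Finset.prod_congr rfl (fun i _ => hterm i), ← map_prod,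
      prod_range_apply_pow_eq_one φ hbj (hfix _ hbj), map_one]

theorem commutingOrderCyclic_of_normal_sylow {G : Type*} [Group G] [Finite G] {p q : ℕ}
    (hp : p.Prime) (hq : q.Prime) (hpq : p ≠ q) (hpd : p ∣ Nat.card G) (P : Sylow p G)
    (hPn : (P : Subgroup G).Normal) (hno : ¬ ∃ g : G, orderOf g = p * q) :
    CommutingOrderCyclic G q := by
  have := Fact.mk hp
  have hfree : ∀ t v : G, orderOf t = q → v ∈ (P : Subgroup G) → Commute t v → v = 1 := by
    intro t v ht hv hc
    by_contra hv1
    obtain ⟨k, hk⟩ := (IsPGroup.iff_orderOf.1 P.isPGroup') ⟨v, hv⟩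
    rw [Subgroup.orderOf_mk] at hk
    cases k with
    | zero => exact hv1 (orderOf_eq_one_iff.1 (by simpa using hk))
    | succ k =>
      have hv' : orderOf (v ^ p ^ k) = p := by
        rw [orderOf_pow_of_dvd (pow_ne_zero _ hp.ne_zero) (hk ▸ pow_dvd_pow p k.le_succ), hk,
          pow_succ, Nat.mul_div_cancel_left _ (pow_pos hp.pos k)]
      refine hno ⟨v ^ p ^ k * t, ?_⟩
      rw [(hc.symm.pow_left _).orderOf_mul_eq_mul_orderOf_of_coprime, hv', ht]
      rw [hv', ht]
      exact (Nat.coprime_primes hp hq).2 hpq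
  have hPnt : Nontrivial P := by
    rw [← Finite.one_lt_card_iff_nontrivial]
    exact hp.one_lt.trans_le (Nat.le_of_dvd Nat.card_pos (P.dvd_card_of_dvd_card hpd))
  have := P.isPGroup'.center_nontrivial
  obtain ⟨v, hv⟩ := exists_ne (1 : Subgroup.center P)
  let V : Subgroup G := (Subgroup.center P).map (P : Subgroup G).subtype
  have hVP : V ≤ P := Subgroup.map_subtype_le _
  have hcomm : ∀ x y : V, x * y = y * x := by
    rintro ⟨_, x, hx, rfl⟩ ⟨_, y, hy, rfl⟩
    exact Subtype.ext (congrArg (P : Subgroup G).subtype (Subgroup.mem_center_iff.1 hy x))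
  let _ : CommGroup V := { (inferInstance : Group V) with mul_comm := hcomm }
  have hVn : V.Normal := ConjAct.normal_of_characteristic_of_normal
  refine commutingOrderCyclic_of_fixedPointFree (V := V) (MulAut.conjNormal (H := V)) hq
    (v := ⟨v, v.1, v.2, rfl⟩) ?_ ?_
  · intro h
    have h' : (v : P) ^ q = 1 := by
      apply Subtype.ext
      simpa using congrArg Subtype.val h
    obtain ⟨k, hk⟩ := (IsPGroup.iff_orderOf.1 P.isPGroup') v
    have hd := orderOf_dvd_of_pow_eq_one h'
    rw [hk] at hd
    have hcop : Nat.Coprime (p ^ k) q := ((Nat.coprime_primes hp hq).2 hpq).pow_left k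
    have h1 : orderOf (v : P) = 1 := hk.trans (Nat.Coprime.eq_one_of_dvd hcop hd)
    exact hv (Subtype.ext (orderOf_eq_one_iff.1 h1))
  · intro t ht w hw
    refine Subtype.ext (hfree t w ht (hVP w.2) ?_)
    have := congrArg Subtype.val hw
    rw [MulAut.conjNormal_apply] at this
    exact mul_inv_eq_iff_eq_mul.1 this

theorem CommutingOrderCyclic.mem_zpowers_of_orderOf_le {G : Type*} [Group G] {q : ℕ}
    (hG : CommutingOrderCyclic G q) (hq : q.Prime) {v : G} {b : ℕ} (hv : orderOf v = q ^ b)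
    (a : ℕ) (hab : a ≤ b) (u : G) (huv : Commute u v) (hu : orderOf u = q ^ a) :
    u ∈ Subgroup.zpowers v := by
  have := Fact.mk hq
  induction a generalizing u with
  | zero =>
    have hu1 : u = 1 := orderOf_eq_one_iff.1 (by simpa using hu)
    exact hu1 ▸ one_mem _
  | succ a ih =>
    have huq : orderOf (u ^ q) = q ^ a := by
      rw [orderOf_pow_of_dvd hq.ne_zero (hu ▸ dvd_pow_self q a.succ_ne_zero), hu, pow_succ,
        Nat.mul_div_cancel _ hq.pos]
    obtain ⟨j, hj⟩ := ih (by omega) (u ^ q) (huv.pow_left q) huq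
    have hj : v ^ j = u ^ q := hj
    obtain ⟨c, rfl⟩ : ∃ c, b = c + 1 := ⟨b - 1, by omega⟩
    have hjd : (q : ℤ) ∣ j := by
      have h1 : v ^ (j * q ^ c) = 1 := by
        have : v ^ (j * (q : ℤ) ^ c) = (u ^ q) ^ q ^ c := by
          rw [zpow_mul, hj, ← Nat.cast_pow, zpow_natCast]
        rw [this, ← orderOf_dvd_iff_pow_eq_one, huq]
        exact pow_dvd_pow q (by omega)
      rw [← orderOf_dvd_iff_zpow_eq_one, hv, Nat.cast_pow, pow_succ'] at h1
      exact Int.dvd_of_mul_dvd_mul_right (pow_ne_zero c (by exact_mod_cast hq.ne_zero)) h1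
    obtain ⟨i, rfl⟩ := hjd
    have hcu : Commute u (v ^ (-i)) := huv.zpow_right _
    have h1 : (u * v ^ (-i)) ^ q = 1 := by
      rw [hcu.mul_pow, ← hj, ← zpow_natCast (v ^ (-i)), ← zpow_mul, ← zpow_add]
      simp [mul_comm]
    have hvc : orderOf (v ^ q ^ c) = q := by
      rw [orderOf_pow_of_dvd (pow_ne_zero _ hq.ne_zero) (hv ▸ pow_dvd_pow q c.le_succ), hv,
        pow_succ, Nat.mul_div_cancel_left _ (pow_pos hq.pos c)]
    have hmem : u * v ^ (-i) ∈ Subgroup.zpowers v := by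
      by_cases h : u * v ^ (-i) = 1
      · rw [h]; exact one_mem _
      · refine Subgroup.zpowers_le.2 (Subgroup.npow_mem_zpowers v (q ^ c)) (hG _ _ ?_
          (orderOf_eq_prime h1 h) hvc)
        exact (huv.mul_left ((Commute.refl v).zpow_left _)).pow_right _
    exact (Subgroup.mul_mem_cancel_right _ (Subgroup.zpow_mem_zpowers v _)).1 hmem

theorem mul_pow_of_conj_eq_zpow {G : Type*} [Group G] {g w : G} {k : ℤ}
    (h : w * g * w⁻¹ = g ^ k) (i : ℤ) (n : ℕ) :
    (g ^ i * w) ^ n = g ^ (i * ∑ l ∈ Finset.range n, k ^ l) * w ^ n := by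
  have hw : ∀ m : ℤ, w * g ^ m = g ^ (k * m) * w := fun m => by
    rw [zpow_mul, ← h, conj_zpow]; group
  induction n with
  | zero => simp
  | succ n ih =>
    rw [pow_succ', ih, geom_sum_succ, mul_assoc, ← mul_assoc w, hw, pow_succ' w, mul_assoc,
      ← mul_assoc (g ^ i), ← zpow_add]
    congr 2
    ring

theorem pow_conj_eq_zpow_pow {G : Type*} [Group G] {g w : G} {k : ℤ}
    (h : w * g * w⁻¹ = g ^ k) (n : ℕ) : w ^ n * g * (w ^ n)⁻¹ = g ^ (k ^ n) := by
  induction n with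
  | zero => simp
  | succ n ih =>
    have : w ^ (n + 1) * g * (w ^ (n + 1))⁻¹ = w * (w ^ n * g * (w ^ n)⁻¹) * w⁻¹ := by
      rw [pow_succ']; group
    rw [this, ih, ← conj_zpow, h, ← zpow_mul, pow_succ']

/-- A `q`-element cannot act on a cyclic `q`-subgroup so that a modular or semidihedral group
arises, if commuting elements of order `q` generate the same subgroup. -/
theorem CommutingOrderCyclic.modEq_one_of_conj {G : Type*} [Group G] {q : ℕ}
    (hG : CommutingOrderCyclic G q) (hq : q.Prime) {g w : G} {k : ℤ} {b m : ℕ}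
    (hg : orderOf g = q ^ (b + 1)) (hw : orderOf w = q ^ m) (h : w * g * w⁻¹ = g ^ k)
    (hkq : k ^ q ≡ 1 [ZMOD (q ^ (b + 1) : ℕ)])
    (hkb : k * q ^ b ≡ q ^ b [ZMOD (q ^ (b + 1) : ℕ)])
    (hsolve : ∀ j : ℤ, k * j ≡ j [ZMOD (q ^ (b + 1) : ℕ)] →
      ∃ i : ℤ, i * ∑ l ∈ Finset.range q, k ^ l + j ≡ 0 [ZMOD (q ^ (b + 1) : ℕ)]) :
    k ≡ 1 [ZMOD (q ^ (b + 1) : ℕ)] := by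
  have := Fact.mk hq
  by_contra hk1
  have hnc : ¬ Commute w g := fun hc => hk1 <| by
    rw [← hg, ← zpow_eq_zpow_iff_modEq, ← h, zpow_one, mul_inv_eq_iff_eq_mul]
    exact hc
  have hwq : Commute (w ^ q) g := by
    have h1 := pow_conj_eq_zpow_pow h q
    rw [zpow_eq_zpow_iff_modEq.2 (hg.symm ▸ hkq), zpow_one, mul_inv_eq_iff_eq_mul] at h1
    exact h1
  obtain ⟨a, -, ha⟩ := (Nat.dvd_prime_pow hq).1 (hw ▸ orderOf_pow_dvd q : orderOf (w ^ q) ∣ q ^ m)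
  have hmem : w ^ q ∈ Subgroup.zpowers g := by
    rcases le_total a (b + 1) with hab | hab
    · exact hG.mem_zpowers_of_orderOf_le hq hg a hab _ hwq ha
    · obtain ⟨j, hj⟩ := hG.mem_zpowers_of_orderOf_le hq ha _ hab g hwq.symm hg
      refine absurd ?_ hnc
      rw [← hj]
      exact ((Commute.refl w).pow_right q).zpow_right j
  obtain ⟨j, hj⟩ := hmem
  have hj : g ^ j = w ^ q := hj
  have hkj : k * j ≡ j [ZMOD (q ^ (b + 1) : ℕ)] := by
    rw [← hg, ← zpow_eq_zpow_iff_modEq, zpow_mul, ← h, conj_zpow, hj, mul_inv_eq_iff_eq_mul]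
    exact (Commute.refl w).pow_right q
  obtain ⟨i, hi⟩ := hsolve j hkj
  have h1 : (g ^ i * w) ^ q = 1 := by
    rw [mul_pow_of_conj_eq_zpow h, ← hj, ← zpow_add, ← zpow_zero g, zpow_eq_zpow_iff_modEq, hg]
    exact hi
  have hgb : orderOf (g ^ q ^ b) = q := by
    rw [orderOf_pow_of_dvd (pow_ne_zero _ hq.ne_zero) (hg ▸ pow_dvd_pow q b.le_succ), hg,
      pow_succ, Nat.mul_div_cancel_left _ (pow_pos hq.pos b)]
  have hwb : Commute w (g ^ q ^ b) := by
    have h2 : w * g ^ q ^ b * w⁻¹ = g ^ q ^ b := by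
      rw [← conj_pow, h, ← zpow_natCast (g ^ k), ← zpow_mul, ← zpow_natCast g,
        zpow_eq_zpow_iff_modEq, hg]
      exact_mod_cast hkb
    exact mul_inv_eq_iff_eq_mul.1 h2
  have hmem : g ^ i * w ∈ Subgroup.zpowers g := by
    by_cases hone : g ^ i * w = 1
    · rw [hone]; exact one_mem _
    · exact Subgroup.zpowers_le.2 (Subgroup.npow_mem_zpowers g (q ^ b)) (hG _ _
        ((((Commute.refl g).zpow_left i).pow_right _).mul_left hwb)
        (orderOf_eq_prime h1 hone) hgb)
  obtain ⟨l, hl⟩ := (Subgroup.mul_mem_cancel_left _ (Subgroup.zpow_mem_zpowers g _)).1 hmem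
  apply hnc
  rw [← hl]
  exact (Commute.refl g).zpow_left l

theorem exists_coprime_orderOf_pow_eq_prime_pow {G : Type*} [Group G] [Finite G] {q : ℕ}
    (hq : q.Prime) (y : G) : ∃ r m : ℕ, Nat.Coprime q r ∧ orderOf (y ^ r) = q ^ m := by
  obtain ⟨m, r, hr, h⟩ := Nat.exists_eq_pow_mul_and_not_dvd (orderOf_pos y).ne' q hq.ne_one
  have hr0 : r ≠ 0 := by rintro rfl; simp at hr
  refine ⟨r, m, (Nat.Prime.coprime_iff_not_dvd hq).2 hr, ?_⟩
  rw [orderOf_pow_of_dvd hr0 (h ▸ dvd_mul_left _ _), h, Nat.mul_div_cancel _ (by omega)]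

theorem CommutingOrderCyclic.orderOf_ne_eight {G : Type*} [Group G] [Finite G]
    (hG : CommutingOrderCyclic G 2) (hcut : IsCutGroup G) (g : G) : orderOf g ≠ 8 := by
  intro hg
  have key : ∀ y : G, ∀ k : ℤ, k = 3 ∨ k = 5 → y * g * y⁻¹ ≠ g ^ k := by
    intro y k hk h
    obtain ⟨r, m, hr, hm⟩ := exists_coprime_orderOf_pow_eq_prime_pow Nat.prime_two y
    obtain ⟨s, rfl⟩ := Nat.coprime_two_left.1 hr
    have hk2 : k ^ 2 ≡ 1 [ZMOD 8] := by rcases hk with rfl | rfl <;> decide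
    have hkr : k ^ (2 * s + 1) ≡ k [ZMOD 8] := by
      have := (hk2.pow s).mul_right k
      rwa [one_pow, one_mul, ← pow_mul, ← pow_succ] at this
    have hw := pow_conj_eq_zpow_pow h (2 * s + 1)
    rw [show g ^ (k ^ (2 * s + 1)) = g ^ k from
      zpow_eq_zpow_iff_modEq.2 (by rw [hg]; exact hkr)] at hw
    have h1 := hG.modEq_one_of_conj Nat.prime_two (b := 2) hg hm hw hk2
      (by rcases hk with rfl | rfl <;> decide) (by
        intro j hj
        rcases hk with rfl | rfl
        · have := hj.dvd
          refine ⟨j / 4, Int.ModEq.symm ((Int.modEq_iff_dvd).2 ?_)⟩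
          norm_num [Finset.sum_range_succ] at this ⊢
          omega
        · have := hj.dvd
          refine ⟨j / 2, Int.ModEq.symm ((Int.modEq_iff_dvd).2 ?_)⟩
          norm_num [Finset.sum_range_succ] at this ⊢
          omega)
    rcases hk with rfl | rfl <;> exact absurd h1 (by decide)
  rcases hcut g 3 (by rw [hg]; decide) with h | h
  · obtain ⟨y, hy⟩ := isConj_iff.1 h.symm
    exact key y 3 (Or.inl rfl) hy
  · obtain ⟨y, hy⟩ := isConj_iff.1 h.symm
    refine key y 5 (Or.inr rfl) ?_
    have h1 : y * g * y⁻¹ = g ^ (-3 : ℤ) := by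
      rw [zpow_neg, ← hy]; group
    rw [h1, zpow_eq_zpow_iff_modEq, hg]
    decide

theorem one_add_mul_pow_modEq (c q : ℤ) (n : ℕ) :
    (1 + c * q) ^ n ≡ 1 + n * c * q [ZMOD q ^ 2] := by
  induction n with
  | zero => simp
  | succ n ih =>
    rw [pow_succ (1 + c * q)]
    refine (ih.mul_right _).trans (Int.modEq_iff_dvd.2 ⟨-(n * c ^ 2), ?_⟩)
    push_cast
    ring

theorem sum_one_add_mul_pow_modEq {q : ℕ} (hodd : Odd q) (c : ℤ) :
    ∑ l ∈ Finset.range q, (1 + c * q) ^ l ≡ q [ZMOD (q : ℤ) ^ 2] := by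
  have h1 : ∑ l ∈ Finset.range q, (1 + c * q) ^ l ≡
      ∑ l ∈ Finset.range q, (1 + l * c * q) [ZMOD (q : ℤ) ^ 2] :=
    Int.ModEq.sum fun l _ => one_add_mul_pow_modEq c q l
  refine h1.trans ?_
  obtain ⟨s, hs⟩ := hodd
  have h2 : ∑ l ∈ Finset.range q, (l : ℤ) = q * s := by
    have := Finset.sum_range_id_mul_two q
    have h3 : (∑ l ∈ Finset.range q, l) * 2 = q * s * 2 := by
      rw [this, hs, Nat.add_sub_cancel]; ring
    have h4 := Nat.eq_of_mul_eq_mul_right two_pos h3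
    rw [← Nat.cast_sum, h4, Nat.cast_mul]
  rw [Finset.sum_add_distrib, ← Finset.sum_mul, ← Finset.sum_mul, h2]
  refine Int.modEq_iff_dvd.2 ⟨-(s * c), ?_⟩
  simp
  ring

theorem CommutingOrderCyclic.orderOf_ne_sq {G : Type*} [Group G] [Finite G] {q : ℕ}
    (hG : CommutingOrderCyclic G q) (hq : q.Prime) (hodd : Odd q) (hcut : IsCutGroup G) (g : G) :
    orderOf g ≠ q ^ 2 := by
  intro hg
  have hq0 : (q : ℤ) ≠ 0 := by exact_mod_cast hq.ne_zero
  have hqp : Prime (q : ℤ) := Nat.prime_iff_prime_int.1 hq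
  have hcast : ((q ^ (1 + 1) : ℕ) : ℤ) = (q : ℤ) ^ 2 := by norm_num
  have key : ∀ y : G, ∀ c : ℤ, ¬ (q : ℤ) ∣ c → y * g * y⁻¹ ≠ g ^ (1 + c * q) := by
    intro y c hc h
    obtain ⟨r, m, hr, hm⟩ := exists_coprime_orderOf_pow_eq_prime_pow hq y
    have hw := pow_conj_eq_zpow_pow h r
    rw [show g ^ ((1 + c * q) ^ r) = g ^ (1 + r * c * q) from zpow_eq_zpow_iff_modEq.2
      (by rw [hg, Nat.cast_pow]; exact one_add_mul_pow_modEq c q r)] at hw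
    have hd : ¬ (q : ℤ) ∣ r * c := by
      intro hdvd
      rcases hqp.dvd_or_dvd hdvd with h' | h'
      · exact (Nat.Prime.coprime_iff_not_dvd hq).1 hr (by exact_mod_cast h')
      · exact hc h'
    generalize (r : ℤ) * c = d at hw hd
    have h1 := hG.modEq_one_of_conj hq (b := 1) hg hm hw
      (by
        rw [hcast]
        refine (one_add_mul_pow_modEq d q q).trans (Int.modEq_iff_dvd.2 ⟨-d, ?_⟩)
        ring)
      (by
        rw [hcast]
        refine Int.modEq_iff_dvd.2 ⟨-d, ?_⟩
        ring)
      (by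
        rw [hcast]
        intro j hj
        obtain ⟨e, he⟩ := hj.dvd
        have hjd : (q : ℤ) ∣ d * j := ⟨-e, mul_left_cancel₀ hq0 (by linear_combination -he)⟩
        obtain ⟨i, rfl⟩ := (hqp.dvd_or_dvd hjd).resolve_left hd
        refine ⟨-i, (((sum_one_add_mul_pow_modEq hodd d).mul_left (-i)).add_right _).trans ?_⟩
        rw [show -i * (q : ℤ) + q * i = 0 by ring])
    rw [hcast] at h1
    obtain ⟨e, he⟩ := h1.dvd
    exact hd ⟨-e, mul_left_cancel₀ hq0 (by linear_combination -he)⟩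
  have hcop : Int.gcd (1 + q) (orderOf g) = 1 := by
    rw [hg, Nat.cast_pow, ← Int.isCoprime_iff_gcd_eq_one]
    exact IsCoprime.pow_right ⟨1, -1, by ring⟩
  have h2 : ¬ (q : ℤ) ∣ 2 := by
    intro h
    have h' : q ∣ 2 := by exact_mod_cast h
    obtain ⟨s, rfl⟩ := hodd
    have := Nat.le_of_dvd two_pos h'
    have := hq.two_le
    omega
  have h1 : ∃ y : G, ∃ ε : ℤ, ε ^ 2 = 1 ∧ y * g * y⁻¹ = g ^ (ε * (1 + q)) := by
    rcases hcut g (1 + q) hcop with h | h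
    · obtain ⟨y, hy⟩ := isConj_iff.1 h.symm
      exact ⟨y, 1, by norm_num, by rw [hy, one_mul]⟩
    · obtain ⟨y, hy⟩ := isConj_iff.1 h.symm
      refine ⟨y, -1, by norm_num, ?_⟩
      rw [neg_one_mul, zpow_neg, ← hy]; group
  obtain ⟨y, ε, hε, hy⟩ := h1
  refine key (y ^ 2) 2 h2 ?_
  rw [pow_conj_eq_zpow_pow hy 2, zpow_eq_zpow_iff_modEq, hg, Nat.cast_pow, mul_pow, hε, one_mul]
  refine Int.modEq_iff_dvd.2 ⟨-1, ?_⟩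
  ring

theorem IsPGroup.pow_prime_pow_eq_one {G : Type*} [Group G] {q : ℕ} (hq : q.Prime)
    (hG : IsPGroup q G) {b : ℕ} (h : ∀ g : G, orderOf g ≠ q ^ (b + 1)) (g : G) :
    g ^ q ^ b = 1 := by
  have := Fact.mk hq
  obtain ⟨m, hm⟩ := IsPGroup.iff_orderOf.1 hG g
  by_cases hmb : m ≤ b
  · exact orderOf_dvd_iff_pow_eq_one.1 (hm ▸ pow_dvd_pow q hmb)
  · obtain ⟨d, rfl⟩ : ∃ d, m = d + (b + 1) := ⟨m - (b + 1), by omega⟩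
    refine absurd ?_ (h (g ^ q ^ d))
    rw [orderOf_pow_of_dvd (pow_ne_zero _ hq.ne_zero) (hm ▸ pow_dvd_pow q (by omega)), hm,
      pow_add, Nat.mul_div_cancel_left _ (pow_pos hq.pos d)]

theorem IsPGroup.exists_mem_center_orderOf_eq {G : Type*} [Group G] [Finite G] [Nontrivial G]
    {q : ℕ} (hq : q.Prime) (hG : IsPGroup q G) : ∃ z ∈ Subgroup.center G, orderOf z = q := by
  have := Fact.mk hq
  have := hG.center_nontrivial
  obtain ⟨n, hn, hc⟩ := (hG.to_subgroup (Subgroup.center G)).nontrivial_iff_card.1 this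
  obtain ⟨z, hz⟩ := exists_prime_orderOf_dvd_card' q (hc ▸ dvd_pow_self q hn.ne')
  exact ⟨z, z.2, by rwa [Subgroup.orderOf_coe]⟩

theorem CommutingOrderCyclic.isCyclic_of_pow_eq_one {G : Type*} [Group G] [Finite G]
    [Nontrivial G] {q : ℕ} (hG : CommutingOrderCyclic G q) (hq : q.Prime) (hp : IsPGroup q G)
    (h : ∀ g : G, g ^ q = 1) : IsCyclic G ∧ Nat.card G = q := by
  have := Fact.mk hq
  obtain ⟨z, hz, hzq⟩ := hp.exists_mem_center_orderOf_eq hq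
  have hall : ∀ g, g ∈ Subgroup.zpowers z := fun g => by
    by_cases hg : g = 1
    · exact hg ▸ one_mem _
    · exact hG g z (Subgroup.mem_center_iff.1 hz g) (orderOf_eq_prime (h g) hg) hzq
  exact ⟨⟨z, hall⟩, by rw [← hzq, orderOf_eq_card_of_forall_mem_zpowers hall]⟩

theorem pow_zmod_val_add {G : Type*} [Group G] {n : ℕ} [NeZero n] {a : G} (ha : a ^ n = 1)
    (i j : ZMod n) : a ^ (i + j).val = a ^ i.val * a ^ j.val := by
  rw [ZMod.val_add, ← pow_add, ← pow_eq_pow_mod _ ha]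

/-- A group of elements `a ^ i` and `x * a ^ i` subject to the quaternion relations is the
quaternion group of order 8. -/
theorem nonempty_mulEquiv_quaternionGroup_two {G : Type*} [Group G] {a x : G}
    (ha : orderOf a = 4) (hx : x ^ 2 = a ^ 2) (hxa : x * a * x⁻¹ = a⁻¹)
    (hmem : x ∉ Subgroup.zpowers a)
    (hall : ∀ g : G, g ∈ Subgroup.zpowers a ∨ x⁻¹ * g ∈ Subgroup.zpowers a) :
    Nonempty (G ≃* QuaternionGroup 2) := by
  have ha4 : a ^ (2 * 2) = 1 := orderOf_dvd_iff_pow_eq_one.1 ha.dvd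
  let E : ZMod (2 * 2) → G := fun i => a ^ i.val
  have hadd : ∀ i j, E (i + j) = E i * E j := pow_zmod_val_add ha4
  have h0 : E 0 = 1 := by simp [E]
  have hneg : ∀ i, E (-i) = (E i)⁻¹ := fun i =>
    eq_inv_of_mul_eq_one_left (by rw [← hadd, neg_add_cancel, h0])
  have hEx : ∀ i, E i * x = x * (E i)⁻¹ := fun i => by
    have h1 : x * (E i) * x⁻¹ = (E i)⁻¹ := by
      simp only [E]
      rw [← conj_pow, hxa, inv_pow]
    have h2 : x * (E i)⁻¹ * x⁻¹ = E i := by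
      rw [← conj_inv, h1, inv_inv]
    exact (mul_inv_eq_iff_eq_mul.1 h2).symm
  have h2 : E ((2 : ℕ) : ZMod (2 * 2)) = x * x :=
    hx.symm.trans (pow_two x)
  let f : QuaternionGroup 2 →* G :=
    { toFun := fun t => match t with
        | .a i => E i
        | .xa i => x * E i
      map_one' := h0
      map_mul' := by
        rintro (i | i) (j | j)
        · simp only [QuaternionGroup.a_mul_a, hadd]
        · simp only [QuaternionGroup.a_mul_xa]
          rw [← mul_assoc, hEx, sub_eq_neg_add, hadd, hneg, mul_assoc]
        · simp only [QuaternionGroup.xa_mul_a, hadd, mul_assoc]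
        · simp only [QuaternionGroup.xa_mul_xa]
          rw [show x * E i * (x * E j) = x * (E i * x) * E j by group, hEx, add_sub_assoc, hadd,
            h2, sub_eq_neg_add, hadd, hneg]
          group }
  have hfa : ∀ i, f (.a i) = E i := fun _ => rfl
  have hfx : ∀ i, f (.xa i) = x * E i := fun _ => rfl
  have hpow : ∀ g ∈ Subgroup.zpowers a, ∃ i, E i = g := by
    rintro _ ⟨k, rfl⟩
    refine ⟨(k : ZMod (2 * 2)), ?_⟩
    change a ^ _ = a ^ k
    rw [← zpow_natCast, zpow_eq_zpow_iff_modEq, ha, ZMod.val_intCast]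
    exact Int.mod_modEq k 4
  refine ⟨(MulEquiv.ofBijective f ⟨(injective_iff_map_eq_one f).2 ?_, fun g => ?_⟩).symm⟩
  · rintro (i | i) hi
    · rw [hfa] at hi
      have hd := orderOf_dvd_of_pow_eq_one hi
      rw [ha] at hd
      have hi0 : i.val = 0 := Nat.eq_zero_of_dvd_of_lt hd (ZMod.val_lt i)
      rw [(ZMod.val_eq_zero i).1 hi0]
      rfl
    · rw [hfx] at hi
      refine absurd ?_ hmem
      rw [eq_inv_of_mul_eq_one_left hi]
      exact inv_mem (Subgroup.npow_mem_zpowers a _)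
  · rcases hall g with hg | hg
    · obtain ⟨i, hi⟩ := hpow g hg
      exact ⟨.a i, hi⟩
    · obtain ⟨i, hi⟩ := hpow _ hg
      exact ⟨.xa i, by rw [hfx, hi, mul_inv_cancel_left]⟩

theorem CommutingOrderCyclic.quaternion_or_isCyclic {G : Type*} [Group G] [Finite G]
    [Nontrivial G] (hG : CommutingOrderCyclic G 2) (hp : IsPGroup 2 G)
    (h4 : ∀ g : G, g ^ 4 = 1) :
    Nonempty (G ≃* QuaternionGroup 2) ∨ (IsCyclic G ∧ Nat.card G ∣ 4) := by
  obtain ⟨z, hz, hz2⟩ := hp.exists_mem_center_orderOf_eq Nat.prime_two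
  have hzc : ∀ g, g * z = z * g := Subgroup.mem_center_iff.1 hz
  have hzz : z * z = 1 := by rw [← pow_two, ← hz2, pow_orderOf_eq_one]
  have hinv : ∀ g : G, g ^ 2 = 1 → g = 1 ∨ g = z := by
    intro g hg
    by_cases hg1 : g = 1
    · exact Or.inl hg1
    · obtain ⟨k, hk⟩ := hG g z (hzc g) (orderOf_eq_prime hg hg1) hz2
      have hk : z ^ k = g := hk
      rcases Int.even_or_odd' k with ⟨l, rfl | rfl⟩
      · refine absurd ?_ hg1
        rw [← hk, zpow_mul, zpow_ofNat, pow_two, hzz, one_zpow]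
      · right
        rw [← hk, zpow_add, zpow_mul, zpow_ofNat, pow_two, hzz, one_zpow, one_mul, zpow_one]
  have hsq : ∀ g : G, g ^ 2 = 1 ∨ g ^ 2 = z := fun g => hinv _ (by rw [← pow_mul]; exact h4 g)
  by_cases hall : ∀ g : G, g ^ 2 = 1
  · obtain ⟨hc, h2⟩ := hG.isCyclic_of_pow_eq_one Nat.prime_two hp hall
    exact Or.inr ⟨hc, by rw [h2]; decide⟩
  push Not at hall
  obtain ⟨a, ha1⟩ := hall
  have haz : a ^ 2 = z := (hsq a).resolve_left ha1
  have ha : orderOf a = 4 := orderOf_eq_prime_pow (p := 2) (n := 1) (by simpa using ha1) (h4 a)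
  have hza : z ∈ Subgroup.zpowers a := haz ▸ Subgroup.npow_mem_zpowers a 2
  have hsmall : ∀ g : G, g ^ 2 = 1 → g ∈ Subgroup.zpowers a := fun g hg => by
    rcases hinv g hg with rfl | rfl
    · exact one_mem _
    · exact hza
  have hcent : ∀ c : G, Commute c a → c ∈ Subgroup.zpowers a := by
    intro c hc
    rcases hsq c with h | h
    · exact hsmall c h
    · refine (Subgroup.mul_mem_cancel_right _ (inv_mem (Subgroup.mem_zpowers a))).1
        (hsmall (c * a⁻¹) ?_)
      rw [hc.inv_right.mul_pow, h, inv_pow, haz, mul_inv_cancel]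
  have hinva : a⁻¹ = z * a := by
    rw [inv_eq_iff_mul_eq_one, ← hzc, ← mul_assoc, ← pow_two, haz, hzz]
  have hconj : ∀ c : G, Commute c a ∨ c * a * c⁻¹ = a⁻¹ := by
    intro c
    have hsame : ∀ ζ : G, ζ = 1 ∨ ζ = z → c * a = ζ * (a * c) →
        Commute c a ∨ c * a * c⁻¹ = a⁻¹ := by
      rintro ζ (rfl | rfl) h
      · exact Or.inl (h.trans (one_mul _))
      · right
        rw [h, hinva]; group
    have hcc : ∃ ζ : G, (ζ = 1 ∨ ζ = z) ∧ c⁻¹ = ζ * c := by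
      rcases hsq c with h | h
      · exact ⟨1, Or.inl rfl, by rw [inv_eq_iff_mul_eq_one, one_mul, ← pow_two, h]⟩
      · exact ⟨z, Or.inr rfl, by rw [inv_eq_iff_mul_eq_one, ← hzc, ← mul_assoc, ← pow_two, h, hzz]⟩
    have hca : ∃ ζ : G, (ζ = 1 ∨ ζ = z) ∧ c * a = ζ * (a⁻¹ * c⁻¹) := by
      rcases hsq (c * a) with h | h
      · refine ⟨1, Or.inl rfl, ?_⟩
        rw [one_mul, ← mul_inv_rev, eq_inv_iff_mul_eq_one, ← pow_two, h]
      · refine ⟨z, Or.inr rfl, ?_⟩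
        rw [← mul_inv_rev, eq_mul_inv_iff_mul_eq, ← pow_two, h]
    obtain ⟨ζ, hζ, h1⟩ := hcc
    obtain ⟨ξ, hξ, h2⟩ := hca
    rw [h1, hinva] at h2
    refine hsame (ξ * z * ζ) ?_ ?_
    · rcases hζ with rfl | rfl <;> rcases hξ with rfl | rfl <;> simp [hzz]
    · have hζc : ζ * a = a * ζ := by rcases hζ with rfl | rfl <;> simp [hzc]
      rw [h2]
      simp only [mul_assoc]
      rw [← mul_assoc ζ a c, hζc, mul_assoc a]
  by_cases hcyc : ∀ g, g ∈ Subgroup.zpowers a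
  · exact Or.inr ⟨⟨a, hcyc⟩, by rw [← orderOf_eq_card_of_forall_mem_zpowers hcyc, ha]⟩
  push Not at hcyc
  obtain ⟨x, hx⟩ := hcyc
  have hxa : x * a * x⁻¹ = a⁻¹ := (hconj x).resolve_left fun h => hx (hcent x h)
  have hx2 : x ^ 2 = a ^ 2 := by
    rw [haz]
    exact (hsq x).resolve_left fun h => hx (hsmall x h)
  refine Or.inl (nonempty_mulEquiv_quaternionGroup_two ha hx2 hxa hx fun g => ?_)
  refine (hconj g).imp (hcent g) fun hg => hcent _ ?_
  have h1 : g * a * g⁻¹ = x * a * x⁻¹ := hg.trans hxa.symm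
  have h2 : x⁻¹ * g * a = x⁻¹ * (g * a * g⁻¹) * g := by group
  change x⁻¹ * g * a = a * (x⁻¹ * g)
  rw [h2, h1]
  group

theorem stmt_8 (G : Type*) [Group G] [Finite G] (hcut : IsCutGroup G)
    (p q : ℕ) (hp : p.Prime) (hq : q.Prime) (hpq : p ≠ q)
    (hpd : p ∣ Nat.card G) (hqd : q ∣ Nat.card G)
    (P : Sylow p G) (Q : Sylow q G) (hPn : (P : Subgroup G).Normal)
    (hno : ¬ ∃ g : G, orderOf g = p * q) :
    Nonempty (↥(Q : Subgroup G) ≃* QuaternionGroup 2) ∨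
    (IsCyclic ↥(Q : Subgroup G) ∧ Nat.card ↥(Q : Subgroup G) ∣ 4) ∨
    (IsCyclic ↥(Q : Subgroup G) ∧ Nat.card ↥(Q : Subgroup G) = q) := by
  have := Fact.mk hq
  have hG := commutingOrderCyclic_of_normal_sylow hp hq hpq hpd P hPn hno
  have hQ := hG.subgroup (Q : Subgroup G)
  have hQnt : Nontrivial (Q : Subgroup G) := by
    rw [← Finite.one_lt_card_iff_nontrivial]
    exact hq.one_lt.trans_le (Nat.le_of_dvd Nat.card_pos (Q.dvd_card_of_dvd_card hqd))
  rcases hq.eq_two_or_odd' with rfl | hodd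
  · have h4 : ∀ g : (Q : Subgroup G), g ^ 4 = 1 :=
      Q.isPGroup'.pow_prime_pow_eq_one hq (b := 2) fun g => by
        rw [← Subgroup.orderOf_coe]
        exact hG.orderOf_ne_eight hcut g
    exact (hQ.quaternion_or_isCyclic Q.isPGroup' h4).imp_right Or.inl
  · have h1 : ∀ g : (Q : Subgroup G), g ^ q = 1 := fun g => by
      simpa using Q.isPGroup'.pow_prime_pow_eq_one hq (b := 1) (fun g => by
        rw [← Subgroup.orderOf_coe]
        exact hG.orderOf_ne_sq hq hodd hcut g) g
    exact Or.inr (Or.inr (hQ.isCyclic_of_pow_eq_one hq Q.isPGroup' h1))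
end

section
/- Let G be a finite cut group whose Sylow 2-subgroups are cyclic, and let p be an odd prime. Then G has no element of order 4·p. Furthermore, if p ≡ 1 (mod 4), then G has no element of order 2·p. -/
section CyclicSylow

variable {G : Type*} [Group G]

lemma isPGroup_zpowers_of_pow_eq_one {p k : ℕ} {a : G} (ha : a ^ p ^ k = 1) :
    IsPGroup p (Subgroup.zpowers a) := by
  rintro ⟨_, i, rfl⟩
  refine ⟨k, Subtype.ext ?_⟩
  show (a ^ i) ^ p ^ k = 1
  rw [← zpow_natCast, zpow_comm, zpow_natCast, ha, one_zpow]

variable [Finite G]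

/-- If the Sylow `2`-subgroups are cyclic, conjugate powers of a `2`-element are equal. -/
lemma zpow_eq_zpow_of_isConj_of_isCyclic_sylow
    (hsyl : ∀ P : Sylow 2 G, IsCyclic ↥(P : Subgroup G)) {a : G} {k : ℕ}
    (ha : a ^ 2 ^ k = 1) {i j : ℤ} (hij : IsConj (a ^ i) (a ^ j)) : a ^ i = a ^ j := by
  rcases eq_or_ne a 1 with rfl | hne
  · simp
  have hp := isPGroup_zpowers_of_pow_eq_one ha
  obtain ⟨P, hP⟩ := hp.exists_le_sylow
  have haP : a ∈ P := hP (Subgroup.mem_zpowers a)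
  have h2 : 2 ∣ Nat.card G := by
    obtain ⟨m, -, hm⟩ := (Nat.dvd_prime_pow Nat.prime_two).1 (orderOf_dvd_of_pow_eq_one ha)
    have hm0 : m ≠ 0 := by
      rintro rfl
      exact hne (orderOf_eq_one_iff.1 (by simpa using hm))
    exact (dvd_pow_self 2 hm0).trans (hm ▸ orderOf_dvd_natCard a)
  have hN := IsCyclic.normalizer_le_centralizer ((Nat.minFac_eq_two_iff _).2 h2) (hsyl P)
  obtain ⟨c, hc⟩ := isConj_iff.1 hij
  have key := MonoidHom.transferSylow_eq_pow_aux P hN (a ^ i) (P.zpow_mem haP i) 1 c⁻¹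
  simp only [pow_one, inv_inv, hc] at key
  exact (key (P.zpow_mem haP j)).symm

/-- If the Sylow `p`-subgroups are cyclic, commuting `p`-elements lie in a common cyclic group, so
one whose order divides that of the other is a power of it. -/
lemma mem_zpowers_of_commute_of_isCyclic_sylow {p : ℕ}
    (hsyl : ∀ P : Sylow p G, IsCyclic ↥(P : Subgroup G)) {a b : G} {k : ℕ}
    (hb : orderOf b = p ^ k) (ha : a ^ p ^ k = 1) (hab : Commute a b) :
    a ∈ Subgroup.zpowers b := by
  classical
  have hbk : b ^ p ^ k = 1 := hb ▸ pow_orderOf_eq_one b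
  have hpa := isPGroup_zpowers_of_pow_eq_one ha
  have hpb := isPGroup_zpowers_of_pow_eq_one hbk
  have hle : Subgroup.zpowers a ≤ Subgroup.normalizer (Subgroup.zpowers b : Set G) := by
    refine le_trans ?_ (Subgroup.centralizer_le_normalizer _)
    rw [Subgroup.zpowers_le, Subgroup.mem_centralizer_iff]
    rintro _ ⟨i, rfl⟩
    exact (hab.zpow_right i).eq.symm
  obtain ⟨P, hP⟩ := (hpa.to_sup_of_normal_right' hpb hle).exists_le_sylow
  have haP : a ∈ P := hP (le_sup_left (a := Subgroup.zpowers a) (Subgroup.mem_zpowers a))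
  have hbP : b ∈ P := hP (le_sup_right (b := Subgroup.zpowers b) (Subgroup.mem_zpowers b))
  have := hsyl P
  let _ : Fintype P := Fintype.ofFinite _
  have hob : orderOf (⟨b, hbP⟩ : P) = p ^ k := by rw [← hb, Subgroup.orderOf_mk]
  have hpos : 0 < p ^ k := hb ▸ orderOf_pos b
  have hcard := IsCyclic.card_pow_eq_one_le (α := P) hpos
  let Z : Finset P := Finset.univ.filter (· ∈ Subgroup.zpowers (⟨b, hbP⟩ : P))
  have hZ : Z.card = p ^ k := by
    rw [← hob, ← Nat.card_zpowers, Nat.card_eq_fintype_card]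
    exact (Fintype.card_subtype _).symm
  have hsub : Z ⊆ Finset.univ.filter fun t : P => t ^ p ^ k = 1 := by
    intro t ht
    obtain ⟨i, rfl⟩ := (Finset.mem_filter.1 ht).2
    rw [Finset.mem_filter]
    refine ⟨Finset.mem_univ _, ?_⟩
    rw [← hob, ← orderOf_dvd_iff_pow_eq_one]
    exact orderOf_dvd_of_mem_zpowers ⟨i, rfl⟩
  have heq := Finset.eq_of_subset_of_card_le hsub (hcard.trans hZ.ge)
  have hmem : (⟨a, haP⟩ : P) ∈ Z := by
    rw [heq, Finset.mem_filter]
    exact ⟨Finset.mem_univ _, Subtype.ext ha⟩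
  obtain ⟨i, hi⟩ := (Finset.mem_filter.1 hmem).2
  exact ⟨i, congrArg Subtype.val hi⟩

lemma IsCutGroup.pow_four_eq_one (hcut : IsCutGroup G)
    (hsyl : ∀ P : Sylow 2 G, IsCyclic ↥(P : Subgroup G)) {a : G} {k : ℕ}
    (ha : a ^ 2 ^ k = 1) : a ^ 4 = 1 := by
  have hcop : Int.gcd 3 (orderOf a) = 1 := by
    have h : Nat.Coprime 3 (2 ^ k) := Nat.Coprime.pow_right k (by norm_num)
    exact h.coprime_dvd_right (orderOf_dvd_of_pow_eq_one ha)
  have hz : a ^ (4 : ℤ) = 1 := by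
    rcases hcut a 3 hcop with h | h
    · have := zpow_eq_zpow_of_isConj_of_isCyclic_sylow hsyl ha (i := 3) (j := 1) (by simpa using h)
      have h2 : a ^ (2 : ℤ) = 1 := by
        rw [show (2 : ℤ) = 3 - 1 by norm_num, zpow_sub, this, mul_inv_cancel]
      rw [show (4 : ℤ) = 2 * 2 by norm_num, zpow_mul, h2, one_zpow]
    · have := zpow_eq_zpow_of_isConj_of_isCyclic_sylow hsyl ha (i := 3) (j := -1) (by simpa using h)
      rw [show (4 : ℤ) = 3 - (-1) by norm_num, zpow_sub, this, mul_inv_cancel]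
  exact_mod_cast hz

/-- If the Sylow `2`-subgroups are cyclic and `x` is a `2`-element commuting with `y`, then a
`2`-element of order dividing that of `x` and commuting with `x` inverts `y` only if `y ^ 2 = 1`. -/
lemma sq_eq_one_of_conj_eq_inv (hsyl : ∀ P : Sylow 2 G, IsCyclic ↥(P : Subgroup G))
    {x y h : G} {k : ℕ} (hx : orderOf x = 2 ^ k) (hh : h ^ 2 ^ k = 1) (hhx : Commute h x)
    (hxy : Commute x y) (hinv : h * y * h⁻¹ = y⁻¹) : y ^ 2 = 1 := by
  obtain ⟨i, rfl⟩ := mem_zpowers_of_commute_of_isCyclic_sylow hsyl hx hh hhx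
  have : y = y⁻¹ := by rw [← hinv]; exact eq_mul_inv_of_mul_eq (hxy.zpow_left i).eq.symm
  rw [sq, mul_eq_one_iff_eq_inv]
  exact this

end CyclicSylow

section Conjugation

variable {G : Type*} [Group G]

lemma conj_pow_of_conj_eq_inv {c y : G} (h : c * y * c⁻¹ = y⁻¹) {m : ℕ} (hm : Odd m) :
    c ^ m * y * (c ^ m)⁻¹ = y⁻¹ := by
  have hsq : Commute (c ^ 2) y := by
    have h' : c * y = y⁻¹ * c := mul_inv_eq_iff_eq_mul.1 h
    have h'' : c * y⁻¹ = y * c := by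
      have := congrArg (·⁻¹) h
      simp only [mul_inv_rev, inv_inv] at this
      rw [← mul_assoc] at this
      exact mul_inv_eq_iff_eq_mul.1 this
    show c ^ 2 * y = y * c ^ 2
    rw [sq, mul_assoc, h', ← mul_assoc, h'', mul_assoc]
  obtain ⟨r, rfl⟩ := hm
  have hr : c ^ (2 * r) * y⁻¹ = y⁻¹ * c ^ (2 * r) := by
    rw [pow_mul]; exact (hsq.pow_left r).inv_right.eq
  rw [pow_succ, mul_inv_rev]
  calc c ^ (2 * r) * c * y * (c⁻¹ * (c ^ (2 * r))⁻¹)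
      = c ^ (2 * r) * (c * y * c⁻¹) * (c ^ (2 * r))⁻¹ := by group
    _ = y⁻¹ := by rw [h, hr, mul_inv_cancel_right]

lemma exists_odd_pow_pow_two_pow_eq_one [Finite G] (c : G) :
    ∃ m k : ℕ, Odd m ∧ (c ^ m) ^ 2 ^ k = 1 := by
  obtain ⟨k, m, hm, h⟩ := Nat.exists_eq_two_pow_mul_odd (orderOf_pos c).ne'
  exact ⟨m, k, hm, by rw [← pow_mul, mul_comm, ← h, pow_orderOf_eq_one]⟩

/-- Conjugacy of integer powers passes to powers of the base, with the same conjugating element. -/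
lemma conj_zpow_pow_eq {c g : G} {i j : ℤ} (h : c * g ^ i * c⁻¹ = g ^ j) (n : ℕ) :
    c * (g ^ n) ^ i * c⁻¹ = (g ^ n) ^ j := by
  rw [← zpow_natCast, zpow_comm g, ← conj_zpow, h, zpow_comm g]

end Conjugation

theorem stmt_9 (G : Type*) [Group G] [Finite G] (hcut : IsCutGroup G)
    (hsyl : ∀ P : Sylow 2 G, IsCyclic ↥(P : Subgroup G))
    (p : ℕ) (hp : p.Prime) (hodd : Odd p) :
    (¬ ∃ g : G, orderOf g = 4 * p) ∧ (p % 4 = 1 → ¬ ∃ g : G, orderOf g = 2 * p) := by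
  have hp2 : ¬ p ∣ 2 := by
    intro h
    have := (Nat.prime_dvd_prime_iff_eq hp Nat.prime_two).1 h
    subst this
    exact absurd hodd (by decide)
  have hp0 := hp.pos
  constructor
  · rintro ⟨g, hg⟩
    have hx : orderOf (g ^ p) = 2 ^ 2 := by
      rw [orderOf_pow_of_dvd hp.ne_zero (by rw [hg]; exact dvd_mul_left _ _), hg,
        Nat.mul_div_cancel _ hp0]
      norm_num
    have hy : orderOf (g ^ 4) = p := by
      rw [orderOf_pow_of_dvd (by norm_num) (by rw [hg]; exact dvd_mul_right _ _), hg,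
        Nat.mul_div_cancel_left _ (by norm_num)]
    have hxy : Commute (g ^ p) (g ^ 4) := Commute.pow_pow_self g p 4
    have hxz : (g ^ p) ^ 2 ^ 2 = 1 := hx ▸ pow_orderOf_eq_one _
    have hcop4 : Nat.Coprime 4 p :=
      Nat.Coprime.pow_left 2 (Nat.coprime_two_left.2 hodd)
    obtain ⟨k, hk4, hkp⟩ := Nat.chineseRemainder hcop4 1 (p - 1)
    have hk4' : (4 : ℤ) ∣ (k : ℤ) - 1 := by
      exact_mod_cast (Nat.modEq_iff_dvd.1 hk4.symm)
    have hkp' : (p : ℤ) ∣ (k : ℤ) + 1 := by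
      have := (Nat.modEq_iff_dvd.1 hkp.symm)
      rw [Nat.cast_sub hp.one_le] at this
      have := dvd_add this (dvd_refl (p : ℤ))
      rwa [show (k : ℤ) - ((p : ℤ) - (1 : ℕ)) + p = k + 1 by push_cast; ring] at this
    have hcop : Int.gcd (k : ℤ) (orderOf g) = 1 := by
      rw [hg, Int.gcd_natCast_natCast]
      refine Nat.Coprime.mul_right ?_ ?_
      · rw [Nat.Coprime, hk4.gcd_eq, Nat.gcd_one_left]
      · rw [Nat.coprime_comm, hp.coprime_iff_not_dvd]
        intro h
        have h1 : (p : ℤ) ∣ 1 := by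
          have := dvd_sub hkp' (Int.natCast_dvd_natCast.2 h)
          simpa using this
        exact hp.one_lt.ne' (Nat.dvd_one.1 (by exact_mod_cast h1))
    have hxk : (g ^ p) ^ (k : ℤ) = (g ^ p) ^ (1 : ℤ) := by
      rw [← orderOf_dvd_sub_iff_zpow_eq_zpow, hx]
      exact_mod_cast hk4'
    have hyk : (g ^ 4) ^ (k : ℤ) = (g ^ 4)⁻¹ := by
      rw [← zpow_neg_one, ← orderOf_dvd_sub_iff_zpow_eq_zpow, hy]
      simpa using hkp'
    rcases hcut g k hcop with h | h
    · obtain ⟨c, hc⟩ := isConj_iff.1 h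
      rw [← zpow_one g, ← zpow_mul, one_mul] at hc
      have hcx := conj_zpow_pow_eq hc p
      have hcy := conj_zpow_pow_eq hc 4
      rw [hxk, zpow_one] at hcx
      rw [hyk, zpow_one] at hcy
      have hcx' : Commute c (g ^ p) := mul_inv_eq_iff_eq_mul.1 hcx
      have hcy' : c * g ^ 4 * c⁻¹ = (g ^ 4)⁻¹ := by
        rw [← inv_inj, inv_inv]
        conv_rhs => rw [← hcy]
        group
      obtain ⟨m, l, hm, hml⟩ := exists_odd_pow_pow_two_pow_eq_one c
      have h4 := hcut.pow_four_eq_one hsyl hml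
      have := sq_eq_one_of_conj_eq_inv hsyl hx h4 (hcx'.pow_left m) hxy
        (conj_pow_of_conj_eq_inv hcy' hm)
      exact hp2 (hy ▸ orderOf_dvd_of_pow_eq_one this)
    · obtain ⟨c, hc⟩ := isConj_iff.1 h
      rw [← zpow_neg_one g] at hc
      have hcx := zpow_eq_zpow_of_isConj_of_isCyclic_sylow hsyl hxz
        (isConj_iff.2 ⟨c, conj_zpow_pow_eq hc p⟩)
      rw [hxk, ← orderOf_dvd_sub_iff_zpow_eq_zpow, hx] at hcx
      norm_num at hcx
  · rintro hp1 ⟨g, hg⟩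
    have hx : orderOf (g ^ p) = 2 ^ 1 := by
      rw [orderOf_pow_of_dvd hp.ne_zero (by rw [hg]; exact dvd_mul_left _ _), hg,
        Nat.mul_div_cancel _ hp0]
      norm_num
    have hy : orderOf (g ^ 2) = p := by
      rw [orderOf_pow_of_dvd (by norm_num) (by rw [hg]; exact dvd_mul_right _ _), hg,
        Nat.mul_div_cancel_left _ (by norm_num)]
    have hxy : Commute (g ^ p) (g ^ 2) := Commute.pow_pow_self g p 2
    obtain ⟨k, hkodd, hkp⟩ : ∃ k : ℤ, Odd k ∧ (p : ℤ) ∣ k ^ 2 + 1 := by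
      have := Fact.mk hp
      obtain ⟨r, hr⟩ := ZMod.exists_sq_eq_neg_one_iff.2 (by omega : p % 4 ≠ 3)
      obtain ⟨r, rfl⟩ := ZMod.intCast_surjective r
      have hrp : (p : ℤ) ∣ r ^ 2 + 1 := by
        rw [← ZMod.intCast_zmod_eq_zero_iff_dvd]
        push_cast
        rw [sq, ← hr, neg_add_cancel]
      rcases Int.even_or_odd r with he | ho
      · refine ⟨r + p, he.add_odd (by exact_mod_cast hodd), ?_⟩
        rw [show (r + p) ^ 2 + 1 = r ^ 2 + 1 + p * (2 * r + p) by ring]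
        exact dvd_add hrp (dvd_mul_right _ _)
      · exact ⟨r, ho, hrp⟩
    have hcop : Int.gcd k (orderOf g) = 1 := by
      rw [hg, ← Int.isCoprime_iff_gcd_eq_one]
      push_cast
      refine IsCoprime.mul_right ?_ ?_
      · obtain ⟨t, rfl⟩ := hkodd
        exact ⟨1, -t, by ring⟩
      · obtain ⟨t, ht⟩ := hkp
        exact ⟨-k, t, by linear_combination -ht⟩
    obtain ⟨ε, hε, c, hc⟩ : ∃ ε : ℤ, ε ^ 2 = 1 ∧ ∃ c, c * g ^ k * c⁻¹ = g ^ ε := by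
      rcases hcut g k hcop with h | h
      · exact ⟨1, by norm_num, by simpa using isConj_iff.1 h⟩
      · exact ⟨-1, by norm_num, by simpa using isConj_iff.1 h⟩
    have hεodd : Odd ε := by
      exact (Int.odd_pow.1 (hε ▸ odd_one)).resolve_right two_ne_zero
    have hxodd : ∀ i : ℤ, Odd i → (g ^ p) ^ i = g ^ p := by
      rintro _ ⟨t, rfl⟩
      conv_rhs => rw [← zpow_one (g ^ p)]
      rw [← orderOf_dvd_sub_iff_zpow_eq_zpow, hx]
      exact ⟨t, by push_cast; ring⟩
    have hcx := conj_zpow_pow_eq hc p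
    rw [hxodd k hkodd, hxodd ε hεodd] at hcx
    have hcx' : Commute c (g ^ p) := mul_inv_eq_iff_eq_mul.1 hcx
    have hcy := conj_zpow_pow_eq hc 2
    have hc2 : c ^ 2 * g ^ 2 * (c ^ 2)⁻¹ = (g ^ 2)⁻¹ := by
      generalize g ^ 2 = y at hy hcy
      have hyk : y ^ (k * k) = y⁻¹ := by
        rw [← zpow_neg_one, ← orderOf_dvd_sub_iff_zpow_eq_zpow, hy]
        convert hkp using 1; ring
      have h1 : c ^ 2 * y ^ (k * k) * (c ^ 2)⁻¹ = y := by
        calc c ^ 2 * y ^ (k * k) * (c ^ 2)⁻¹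
            = c * (c * y ^ k * c⁻¹) ^ k * c⁻¹ := by rw [conj_zpow, ← zpow_mul, sq, mul_inv_rev]; simp only [mul_assoc]
          _ = (y ^ ε) ^ ε := by rw [hcy, zpow_comm, ← conj_zpow, hcy]
          _ = y := by rw [← zpow_mul, ← sq, hε, zpow_one]
      rw [hyk] at h1
      rw [← inv_inj, inv_inv]
      conv_rhs => rw [← h1]
      group
    obtain ⟨m, l, hm, hml⟩ := exists_odd_pow_pow_two_pow_eq_one c
    have h4 := hcut.pow_four_eq_one hsyl hml
    have hh : ((c ^ 2) ^ m) ^ 2 ^ 1 = 1 := by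
      rw [← h4, ← pow_mul, ← pow_mul, ← pow_mul]; ring_nf
    have := sq_eq_one_of_conj_eq_inv hsyl hx hh ((hcx'.pow_left 2).pow_left m) hxy
      (conj_pow_of_conj_eq_inv hc2 hm)
    exact hp2 (hy ▸ orderOf_dvd_of_pow_eq_one this)
end

section
/- Let G be a finite cut group whose Sylow 2-subgroups are isomorphic to the quaternion group of order 8. Then for every prime p with p ≡ 1 (mod 4), the group G has no element of order 2·p. -/
/-- In the quaternion group of order `8`, every nontrivial square is the unique involution. -/
lemma QuaternionGroup.sq_eq_of_involution :
    ∀ a b : QuaternionGroup 2, a ^ 2 ≠ 1 → b ^ 2 = 1 → b ≠ 1 → a ^ 2 = b := by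
  decide

/-- If the Sylow `2`-subgroups are quaternion of order `8` and the `2`-element `t` commutes with
the involution `z` and satisfies `t ^ 2 ≠ 1`, then `t ^ 2 = z`. -/
lemma sq_eq_of_commute_of_sylow_quaternion {G : Type*} [Group G]
    (hsyl : ∀ P : Sylow 2 G, Nonempty (↥(P : Subgroup G) ≃* QuaternionGroup 2))
    {t z : G} {a : ℕ} (ht : t ^ 2 ^ a = 1) (ht2 : t ^ 2 ≠ 1) (hz : z ^ 2 = 1) (hz1 : z ≠ 1)
    (htz : Commute t z) : t ^ 2 = z := by
  have isPGroup_zpowers : ∀ (x : G) (n : ℕ), x ^ 2 ^ n = 1 → IsPGroup 2 (Subgroup.zpowers x) := by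
    rintro x n hx ⟨_, i, rfl⟩
    refine ⟨n, Subtype.ext ?_⟩
    change (x ^ i) ^ 2 ^ n = 1
    rw [← zpow_natCast, zpow_comm, zpow_natCast, hx, one_zpow]
  have hle : Subgroup.zpowers t ≤ Subgroup.normalizer (Subgroup.zpowers z : Set G) := by
    rw [Subgroup.zpowers_le]
    apply Subgroup.centralizer_le_normalizer
    rintro _ ⟨i, rfl⟩
    exact (htz.zpow_right i).symm.eq
  have hsup : IsPGroup 2 ↥(Subgroup.zpowers t ⊔ Subgroup.zpowers z) :=
    (isPGroup_zpowers t a ht).to_sup_of_normal_right' (isPGroup_zpowers z 1 (by simpa using hz)) hle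
  obtain ⟨P, hP⟩ := hsup.exists_le_sylow
  obtain ⟨e⟩ := hsyl P
  let t' : ↥(P : Subgroup G) :=
    ⟨t, hP ((le_sup_left : _ ≤ _ ⊔ Subgroup.zpowers z) (Subgroup.mem_zpowers t))⟩
  let z' : ↥(P : Subgroup G) :=
    ⟨z, hP ((le_sup_right : _ ≤ Subgroup.zpowers t ⊔ _) (Subgroup.mem_zpowers z))⟩
  have key : e t' ^ 2 = e z' := by
    apply QuaternionGroup.sq_eq_of_involution
    · rw [← map_pow, Ne, map_eq_one_iff e e.injective]
      exact fun h => ht2 (congrArg Subtype.val h)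
    · rw [← map_pow, map_eq_one_iff e e.injective]
      exact Subtype.ext hz
    · rw [Ne, map_eq_one_iff e e.injective]
      exact fun h => hz1 (congrArg Subtype.val h)
  rw [← map_pow] at key
  exact congrArg Subtype.val (e.injective key)

/-- For a prime `p ≡ 1 (mod 4)`, there is an odd square root of `-1` modulo `2 * p`. -/
lemma exists_odd_sq_add_one_dvd {p : ℕ} (hp : p.Prime) (hmod : p % 4 = 1) :
    ∃ k : ℤ, Odd k ∧ ((2 * p : ℕ) : ℤ) ∣ k ^ 2 + 1 := by
  have := Fact.mk hp
  obtain ⟨y, hy⟩ := (ZMod.exists_sq_eq_neg_one_iff (p := p)).2 (by omega)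
  obtain ⟨k, rfl⟩ := ZMod.intCast_surjective y
  have hpodd : Odd (p : ℤ) := ⟨p / 2, by omega⟩
  have hdvd : ∀ n : ℤ, (n : ZMod p) = k → (p : ℤ) ∣ n ^ 2 + 1 := by
    intro n hn
    rw [← ZMod.intCast_zmod_eq_zero_iff_dvd]
    push_cast
    rw [hn, sq, ← hy]
    ring
  obtain ⟨n, hn, hodd⟩ : ∃ n : ℤ, (n : ZMod p) = k ∧ Odd n := by
    rcases Int.even_or_odd k with h | h
    · exact ⟨k + p, by simp, h.add_odd hpodd⟩
    · exact ⟨k, rfl, h⟩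
  refine ⟨n, hodd, ?_⟩
  push_cast
  refine IsCoprime.mul_dvd ?_ (hodd.pow.add_odd odd_one).two_dvd (hdvd n hn)
  obtain ⟨m, hm⟩ := hpodd
  exact ⟨-m, 1, by rw [hm]; ring⟩

theorem stmt_10 (G : Type*) [Group G] [Finite G] (hcut : IsCutGroup G)
    (hsyl : ∀ P : Sylow 2 G, Nonempty (↥(P : Subgroup G) ≃* QuaternionGroup 2))
    (p : ℕ) (hp : p.Prime) (hmod : p % 4 = 1) :
    ¬ ∃ g : G, orderOf g = 2 * p := by
  rintro ⟨g, hg⟩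
  have hp2 : 2 ≤ p := hp.two_le
  obtain ⟨k, hkodd, hk⟩ := exists_odd_sq_add_one_dvd hp hmod
  have hcop : Int.gcd k (orderOf g) = 1 := by
    rw [hg, ← Int.isCoprime_iff_gcd_eq_one]
    obtain ⟨m, hm⟩ := hk
    exact ⟨-k, m, by linear_combination -hm⟩
  obtain ⟨l, hlodd, hl, c, hc⟩ : ∃ l : ℤ, Odd l ∧ ((2 * p : ℕ) : ℤ) ∣ l ^ 2 + 1 ∧
      ∃ c : G, SemiconjBy c g (g ^ l) := by
    rcases hcut g k hcop with h | h
    · obtain ⟨c, hc⟩ := isConj_iff.1 h.symm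
      exact ⟨k, hkodd, hk, c, by rw [SemiconjBy, ← hc]; group⟩
    · obtain ⟨c, hc⟩ := isConj_iff.1 h.symm
      refine ⟨-k, hkodd.neg, by simpa using hk, c, ?_⟩
      rw [SemiconjBy, zpow_neg, ← hc]
      group
  have hc2 : SemiconjBy (c ^ 2) g g⁻¹ := by
    have h := (hc.zpow_right l).mul_left hc
    rwa [← sq, ← zpow_mul, ← sq, (eq_inv_of_mul_eq_one_left (a := g ^ l ^ 2) (b := g) (by
      rw [← zpow_add_one, ← orderOf_dvd_iff_zpow_eq_one, hg]
      exact hl))] at h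
  have hz : (g ^ p) ^ 2 = 1 := by rw [← pow_mul, mul_comm, ← hg, pow_orderOf_eq_one]
  have hz1 : g ^ p ≠ 1 := by
    intro h
    have := Nat.le_of_dvd (by omega) (orderOf_dvd_of_pow_eq_one h)
    omega
  have hcz : Commute c (g ^ p) := by
    have h := hc.pow_right p
    obtain ⟨j, rfl⟩ := hlodd
    rwa [← zpow_natCast (g ^ _), zpow_comm, zpow_natCast, zpow_add_one, zpow_mul,
      zpow_ofNat, hz, one_zpow, one_mul] at h
  obtain ⟨a, m, hmodd, hm⟩ := Nat.exists_eq_two_pow_mul_odd (orderOf_pos c).ne'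
  have ht : (c ^ m) ^ 2 ^ a = 1 := by rw [← pow_mul, mul_comm, ← hm, pow_orderOf_eq_one]
  have ht2 : SemiconjBy ((c ^ m) ^ 2) g g⁻¹ := by
    obtain ⟨j, rfl⟩ := hmodd
    have h4 : Commute ((c ^ 2) ^ 2) g := by
      have h := hc2.inv_right.mul_left hc2
      rwa [inv_inv, ← sq] at h
    rw [← pow_mul, mul_comm, pow_mul, pow_succ', pow_mul (c ^ 2)]
    exact hc2.mul_left (h4.pow_left j)
  have hginv : g ≠ g⁻¹ := by
    intro h
    have := Nat.le_of_dvd two_pos (orderOf_dvd_of_pow_eq_one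
      (show g ^ 2 = 1 by rw [sq]; exact mul_eq_one_iff_eq_inv.2 h))
    omega
  have hsq := sq_eq_of_commute_of_sylow_quaternion hsyl ht (fun h => hginv (by
    rw [h] at ht2; simpa [SemiconjBy] using ht2)) hz hz1 (hcz.pow_left m)
  rw [hsq] at ht2
  exact hginv (mul_right_cancel
    ((((Commute.refl g).pow_left p).eq.symm).trans ht2.eq))
end

section
/- Let G be a finite cut group whose Sylow 3-subgroups are cyclic. Then G has no element of order 21. -/
/-- Conjugation by `u ^ m` iterates the power map induced by `u`. -/
theorem pow_conj_eq_pow_pow {G : Type*} [Group G] {u g : G} {k : ℕ}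
    (h : u * g * u⁻¹ = g ^ k) (m : ℕ) : u ^ m * g * (u ^ m)⁻¹ = g ^ k ^ m := by
  induction m with
  | zero => simp
  | succ m ih =>
    calc u ^ (m + 1) * g * (u ^ (m + 1))⁻¹ = u ^ m * (u * g * u⁻¹) * (u ^ m)⁻¹ := by
          rw [pow_succ]; group
      _ = (u ^ m * g * (u ^ m)⁻¹) ^ k := by rw [h, conj_pow]
      _ = g ^ k ^ (m + 1) := by rw [ih, ← pow_mul, ← pow_succ]

/-- If `g` is inverse semi-rational, the square of every exponent coprime to the order of `g`
is realised by conjugation. -/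
theorem IsInverseSemiRationalElement.exists_conj_eq_pow_sq {G : Type*} [Group G] {g : G}
    (hg : IsInverseSemiRationalElement g) {k : ℕ} (hk : k.Coprime (orderOf g)) :
    ∃ u : G, u * g * u⁻¹ = g ^ k ^ 2 := by
  have hc : ∃ c : G, c * g * c⁻¹ = g ^ k ∨ c * g * c⁻¹ = (g ^ k)⁻¹ := by
    rcases hg k (by simpa [Int.gcd_natCast_natCast] using hk) with h | h
    · obtain ⟨c, hc⟩ := isConj_iff.1 h.symm
      exact ⟨c, Or.inl (by simpa using hc)⟩
    · obtain ⟨c, hc⟩ := isConj_iff.1 h.symm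
      refine ⟨c, Or.inr ?_⟩
      rw [← zpow_natCast, ← hc]
      group
  obtain ⟨c, hc | hc⟩ := hc
  · exact ⟨c ^ 2, pow_conj_eq_pow_pow hc 2⟩
  · refine ⟨c ^ 2, ?_⟩
    calc c ^ 2 * g * (c ^ 2)⁻¹ = c * (c * g * c⁻¹) * c⁻¹ := by rw [pow_two]; group
      _ = ((c * g * c⁻¹) ^ k)⁻¹ := by rw [conj_pow, hc, conj_inv]
      _ = g ^ k ^ 2 := by rw [hc, inv_pow, inv_inv, ← pow_mul, ← pow_two]

/-- Every element of a finite group has a power of `p`-power order with exponent prime to `p`. -/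
theorem exists_orderOf_pow_eq_prime_pow {G : Type*} [Group G] [Finite G] (p : ℕ) [Fact p.Prime]
    (u : G) : ∃ m a : ℕ, ¬ p ∣ m ∧ orderOf (u ^ m) = p ^ a := by
  obtain ⟨a, m, hm, h⟩ := Nat.exists_eq_pow_mul_and_not_dvd (orderOf_pos u).ne' p
    (Fact.out : p.Prime).ne_one
  have hm0 : m ≠ 0 := by rintro rfl; simp at hm
  refine ⟨m, a, hm, ?_⟩
  rw [orderOf_pow_of_dvd hm0 (h ▸ dvd_mul_left m _), h,
    Nat.mul_div_cancel _ (Nat.pos_of_ne_zero hm0)]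

/-- A `p`-element normalising the subgroup generated by another `p`-element lies with it
in a common Sylow `p`-subgroup. -/
theorem exists_sylow_mem_of_conj_eq_pow {G : Type*} [Group G] [Finite G] {p : ℕ} [Fact p.Prime]
    {v t : G} {a b n : ℕ} (hv : orderOf v = p ^ a) (ht : orderOf t = p ^ b)
    (h : v * t * v⁻¹ = t ^ n) : ∃ P : Sylow p G, v ∈ P ∧ t ∈ P := by
  have hV : IsPGroup p (Subgroup.zpowers v) := IsPGroup.of_card (by rw [Nat.card_zpowers, hv])
  have hT : IsPGroup p (Subgroup.zpowers t) := IsPGroup.of_card (by rw [Nat.card_zpowers, ht])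
  have hle : Subgroup.zpowers v ≤ Subgroup.normalizer (Subgroup.zpowers t : Set G) := by
    rw [Subgroup.zpowers_le]
    have hmap : (Subgroup.zpowers t).map (MulAut.conj v).toMonoidHom = Subgroup.zpowers t := by
      refine Subgroup.eq_of_le_of_card_ge ?_ ?_
      · rw [MonoidHom.map_zpowers, Subgroup.zpowers_le]
        exact ⟨n, by simp [h]⟩
      · rw [Subgroup.card_map_of_injective (MulAut.conj v).injective]
    rw [Subgroup.mem_normalizer_iff_map_conj_eq]
    exact hmap
  obtain ⟨P, hP⟩ := (hV.to_sup_of_normal_right' hT hle).exists_le_sylow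
  exact ⟨P, hP (Subgroup.mem_sup_left (Subgroup.mem_zpowers v)),
    hP (Subgroup.mem_sup_right (Subgroup.mem_zpowers t))⟩

/-- In a cut group the power map by `k ^ 2` on `⟨g⟩` has a prime-to-`p` iterate realised by
conjugation by a `p`-element. -/
theorem IsCutGroup.exists_conj_eq_pow {G : Type*} [Group G] [Finite G] (hcut : IsCutGroup G)
    (p : ℕ) [Fact p.Prime] {g : G} {k : ℕ} (hk : k.Coprime (orderOf g)) :
    ∃ (v : G) (m a : ℕ), ¬ p ∣ m ∧ orderOf v = p ^ a ∧ v * g * v⁻¹ = g ^ (k ^ 2) ^ m := by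
  obtain ⟨u, hu⟩ := (hcut g).exists_conj_eq_pow_sq hk
  obtain ⟨m, a, hm, ha⟩ := exists_orderOf_pow_eq_prime_pow p u
  exact ⟨u ^ m, m, a, hm, ha, pow_conj_eq_pow_pow hu m⟩

theorem IsCutGroup.orderOf_ne_nine {G : Type*} [Group G] [Finite G] (hcut : IsCutGroup G)
    (hsyl : ∀ P : Sylow 3 G, IsCyclic ↥(P : Subgroup G)) (t : G) : orderOf t ≠ 9 := by
  intro ht
  obtain ⟨v, m, a, hm, hv, h⟩ := hcut.exists_conj_eq_pow 3 (g := t) (k := 4) (by rw [ht]; decide)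
  obtain ⟨P, hvP, htP⟩ := exists_sylow_mem_of_conj_eq_pow (b := 2) hv (by rw [ht]; rfl) h
  have := hsyl P
  have hcomm : v * t = t * v :=
    congrArg Subtype.val
      (IsCyclic.isMulCommutative.is_comm.comm (α := (P : Subgroup G)) ⟨v, hvP⟩ ⟨t, htP⟩)
  rw [hcomm, mul_inv_cancel_right] at h
  have hmod : 1 ≡ (4 ^ 2) ^ m [MOD 9] := by
    rw [← ht, ← pow_eq_pow_iff_modEq, pow_one]; exact h
  rw [← Nat.div_add_mod m 3, pow_add, pow_mul] at hmod
  have h1 : ((4 ^ 2) ^ 3) ^ (m / 3) ≡ 1 ^ (m / 3) [MOD 9] := Nat.ModEq.pow _ (by decide)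
  have h2 := hmod.trans (h1.mul_right ((4 ^ 2) ^ (m % 3)))
  rw [one_pow, one_mul] at h2
  have : m % 3 = 1 ∨ m % 3 = 2 := by omega
  rcases this with h3 | h3 <;> rw [h3] at h2 <;> revert h2 <;> decide

/-- A cut group with cyclic Sylow `3`-subgroups has Sylow `3`-subgroups of order at most `3`. -/
theorem IsCutGroup.card_sylow_three_dvd {G : Type*} [Group G] [Finite G] (hcut : IsCutGroup G)
    (hsyl : ∀ P : Sylow 3 G, IsCyclic ↥(P : Subgroup G)) (P : Sylow 3 G) :
    Nat.card (P : Subgroup G) ∣ 3 := by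
  have := hsyl P
  obtain ⟨c, hc⟩ := IsCyclic.exists_ofOrder_eq_natCard (α := (P : Subgroup G))
  obtain ⟨b, hb⟩ := IsPGroup.iff_card.1 P.isPGroup'
  rw [hb]
  by_contra hcon
  have hb2 : 2 ≤ b := by
    by_contra hlt
    exact hcon (pow_dvd_pow 3 (show b ≤ 1 by omega))
  obtain ⟨d, rfl⟩ := Nat.exists_eq_add_of_le hb2
  refine hcut.orderOf_ne_nine hsyl ((c ^ 3 ^ d : (P : Subgroup G)) : G) ?_
  rw [Subgroup.orderOf_coe, orderOf_pow_of_dvd (by positivity), hc, hb, pow_add,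
    Nat.mul_div_cancel _ (by positivity)]
  · norm_num
  · rw [hc, hb, pow_add]; exact dvd_mul_left _ _

theorem stmt_11 (G : Type*) [Group G] [Finite G] (hcut : IsCutGroup G)
    (hsyl : ∀ P : Sylow 3 G, IsCyclic ↥(P : Subgroup G)) :
    ¬ ∃ g : G, orderOf g = 21 := by
  rintro ⟨g, hg⟩
  obtain ⟨v, m, a, hm, hv, h⟩ := hcut.exists_conj_eq_pow 3 (g := g) (k := 16) (by rw [hg]; decide)
  have hx : orderOf (g ^ 7) = 3 := by
    rw [orderOf_pow_of_dvd (by norm_num) (by rw [hg]; norm_num), hg]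
  obtain ⟨P, hvP, hxP⟩ := exists_sylow_mem_of_conj_eq_pow (t := g ^ 7) (b := 1)
    (n := (16 ^ 2) ^ m) hv (by rw [hx, pow_one])
    (by rw [← conj_pow, h, pow_right_comm])
  have hle : Subgroup.zpowers (g ^ 7) ≤ (P : Subgroup G) := (Subgroup.zpowers_le).2 hxP
  have heq : Subgroup.zpowers (g ^ 7) = (P : Subgroup G) :=
    Subgroup.eq_of_le_of_card_ge hle (by
      rw [Nat.card_zpowers, hx]
      exact Nat.le_of_dvd (by norm_num) (hcut.card_sylow_three_dvd hsyl P))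
  have hvx : v ∈ Subgroup.zpowers (g ^ 7) := heq ▸ hvP
  obtain ⟨z, rfl⟩ := hvx
  have hcomm : Commute ((g ^ 7) ^ z) g := ((Commute.refl g).pow_left 7).zpow_left z
  rw [hcomm.eq, mul_inv_cancel_right] at h
  have hmod : 1 ≡ (16 ^ 2) ^ m [MOD 21] := by
    rw [← hg, ← pow_eq_pow_iff_modEq, pow_one]; exact h
  rw [← Nat.div_add_mod m 3, pow_add, pow_mul] at hmod
  have h1 : ((16 ^ 2) ^ 3) ^ (m / 3) ≡ 1 ^ (m / 3) [MOD 21] := Nat.ModEq.pow _ (by decide)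
  have h2 := hmod.trans (h1.mul_right ((16 ^ 2) ^ (m % 3)))
  rw [one_pow, one_mul] at h2
  have : m % 3 = 1 ∨ m % 3 = 2 := by omega
  rcases this with h3 | h3 <;> rw [h3] at h2 <;> revert h2 <;> decide
end
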